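/- arXiv:1101.4852 — 2 statements merged into one kernel-verified Lean document; each statement's English description precedes it below -/
import Mathlib

section
/- Matrix-valued Cartan lemma (Bourgain): There exist absolute constants C, c > 0 with the following property. Let n, N, m be positive integers with m ≤ N, let B₁, B₂, B₃ > 1, let [a,b] ⊂ ℝ, Ω := [a,b]^n, and D := {z ∈ ℂ : |z − (a+b)/2| < (e/2)(b−a)}. Let Γ : D^n → (N×N complex matrices) be analytic, with Γ(x) Hermitian for x ∈ Ω, and suppose: (1) ‖Γ(z)‖ < B₁ for all z ∈ D^n; (2) there is a subset J ⊂ {1,…,N} with |J| ≤ m such that for every z ∈ D^n the principal submatrix of Γ(z) indexed by {1,…,N}\J is invertible with inverse of operator norm < B₂; (3) there exists ω' ∈ Ω such that Γ(ω') is invertible with ‖Γ(ω')^{−1}‖ < B₃. Let μ be a measure on Ω having a bounded density g with respect to Lebesgue measure. Then for every K > 0, μ({x ∈ Ω : Γ(x) is not invertible, or ‖Γ(x)^{−1}‖ > K}) ≤ C ‖g‖_∞ n (b−a)^n K^{−c/(m log(B₁B₂B₃))}. -/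
set_option autoImplicit false

open MeasureTheory
open scoped Classical
noncomputable section

/-- The `ℓ² → ℓ²` operator norm of a complex square matrix. -/
def opNorm {n : Type*} [Fintype n] [DecidableEq n] (M : Matrix n n ℂ) : ℝ :=
  ‖Matrix.toEuclideanCLM (𝕜 := ℂ) M‖

open Metric Set in
/-- **Harnack's inequality** for the real part of a holomorphic function on a disc. -/
theorem harnack_re_of_pos {f : ℂ → ℂ} {R k : ℝ} (hR : 0 < R) (hk : k < 1)
    (hf : DifferentiableOn ℂ f (ball 0 R)) (hpos : ∀ w ∈ ball (0 : ℂ) R, 0 < (f w).re)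
    {z : ℂ} (hz : ‖z‖ ≤ k * R) :
    (1 - k) * (f z).re ≤ (1 + k) * (f 0).re ∧ (1 - k) * (f 0).re ≤ (1 + k) * (f z).re := by
  have hk0 : 0 ≤ k := by
    by_contra! h
    nlinarith [norm_nonneg z]
  have h0mem : (0 : ℂ) ∈ ball (0 : ℂ) R := mem_ball_self hR
  have hzmem : z ∈ ball (0 : ℂ) R := by
    rw [mem_ball_zero_iff]; nlinarith
  have h0 := hpos 0 h0mem
  have hden : ∀ w ∈ ball (0 : ℂ) R, f w + (starRingEnd ℂ) (f 0) ≠ 0 := by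
    intro w hw h
    have := congrArg Complex.re h
    simp at this
    linarith [hpos w hw]
  set h : ℂ → ℂ := fun w => (f w - f 0) / (f w + (starRingEnd ℂ) (f 0)) with hh
  have hh0 : h 0 = 0 := by simp [hh]
  have hd : DifferentiableOn ℂ h (ball 0 R) :=
    (hf.sub_const _).div (hf.add_const _) hden
  have hmaps : MapsTo h (ball 0 R) (closedBall (h 0) 1) := by
    intro w hw
    rw [hh0, mem_closedBall_zero_iff, hh]
    simp only [norm_div]
    refine div_le_one_of_le₀ ?_ (norm_nonneg _)
    rw [← sq_le_sq₀ (norm_nonneg _) (norm_nonneg _), Complex.sq_norm, Complex.sq_norm,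
      Complex.normSq_apply, Complex.normSq_apply]
    simp only [Complex.sub_re, Complex.sub_im, Complex.add_re, Complex.add_im, Complex.conj_re,
      Complex.conj_im]
    nlinarith [hpos w hw, mul_pos (hpos w hw) h0]
  have key := Complex.dist_le_div_mul_dist_of_mapsTo_ball hd hmaps hzmem
  rw [hh0, dist_zero_right, dist_zero_right] at key
  have key2 : ‖h z‖ ≤ k := key.trans (by
    rw [div_mul_eq_mul_div, one_mul, div_le_iff₀ hR]; exact hz)
  have key3 : ‖f z - f 0‖ ≤ k * ‖f z + (starRingEnd ℂ) (f 0)‖ := by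
    rw [hh] at key2
    simp only [norm_div] at key2
    rwa [div_le_iff₀ (norm_pos_iff.2 (hden z hzmem))] at key2
  have key4 : ((f z).re - (f 0).re) ^ 2 ≤ (k * ((f z).re + (f 0).re)) ^ 2 := by
    have h1 := pow_le_pow_left₀ (norm_nonneg _) key3 2
    rw [mul_pow, Complex.sq_norm, Complex.sq_norm, Complex.normSq_apply,
      Complex.normSq_apply] at h1
    simp only [Complex.sub_re, Complex.sub_im, Complex.add_re, Complex.add_im, Complex.conj_re,
      Complex.conj_im] at h1
    have h2 : k ^ 2 ≤ 1 := by nlinarith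
    nlinarith [sq_nonneg ((f z).im - (f 0).im)]
  have hz0 := hpos z hzmem
  have key5 := abs_le_of_sq_le_sq' key4 (by positivity)
  constructor <;> nlinarith [key5.1, key5.2]

open Metric Set in
theorem harnack_re {f : ℂ → ℂ} (hf : DifferentiableOn ℂ f (ball 0 (1 / 2)))
    (hpos : ∀ w ∈ ball (0 : ℂ) (1 / 2), 0 ≤ (f w).re)
    {z w : ℂ} (hz : ‖z‖ ≤ 2 / 5) (hw : ‖w‖ ≤ 2 / 5) :
    (f z).re ≤ 81 * (f w).re := by
  refine le_of_forall_pos_le_add fun ε hε => ?_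
  have hd : DifferentiableOn ℂ (fun x => f x + ((ε / 80 : ℝ) : ℂ)) (ball 0 (1 / 2)) :=
    hf.add_const _
  have hp : ∀ x ∈ ball (0 : ℂ) (1 / 2), 0 < (f x + ((ε / 80 : ℝ) : ℂ)).re := by
    intro x hx
    have := hpos x hx
    simp only [Complex.add_re, Complex.ofReal_re]
    positivity
  have h1 := (harnack_re_of_pos (k := 4 / 5) (by norm_num) (by norm_num) hd hp
    (z := z) (by linarith)).1
  have h2 := (harnack_re_of_pos (k := 4 / 5) (by norm_num) (by norm_num) hd hp
    (z := w) (by linarith)).2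
  simp only [Complex.add_re, Complex.ofReal_re] at h1 h2
  linarith

open Metric Set in
theorem exists_log_of_ne_zero {g : ℂ → ℂ} {R : ℝ} (hR : 0 < R)
    (hg : DifferentiableOn ℂ g (ball 0 R)) (hne : ∀ w ∈ ball (0 : ℂ) R, g w ≠ 0) :
    ∃ φ : ℂ → ℂ, DifferentiableOn ℂ φ (ball 0 R) ∧ ∀ w ∈ ball (0 : ℂ) R, g w = Complex.exp (φ w) := by
  have hd : DifferentiableOn ℂ (fun w => deriv g w / g w) (ball 0 R) :=
    (hg.deriv isOpen_ball).div hg hne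
  obtain ⟨φ, hφ⟩ := hd.isExactOn_ball
  have hφd : DifferentiableOn ℂ φ (ball 0 R) := fun x hx =>
    (hφ x hx).differentiableAt.differentiableWithinAt
  have h0mem : (0 : ℂ) ∈ ball (0 : ℂ) R := mem_ball_self hR
  have hconst : ∀ w ∈ ball (0 : ℂ) R, g w * Complex.exp (-φ w) = g 0 * Complex.exp (-φ 0) := by
    intro w hw
    refine (convex_ball (0 : ℂ) R).is_const_of_fderivWithin_eq_zero (𝕜 := ℂ)
      (f := fun w => g w * Complex.exp (-φ w)) ?_ ?_ hw h0mem
    · exact hg.mul hφd.neg.cexp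
    · intro x hx
      have h1 : HasDerivAt (fun w => g w * Complex.exp (-φ w)) 0 x := by
        have h2 : g x * (deriv g x / g x) = deriv g x := mul_div_cancel₀ _ (hne x hx)
        have h3 : deriv g x * Complex.exp (-φ x) +
            g x * (Complex.exp (-φ x) * -(deriv g x / g x)) = 0 := by
          linear_combination -Complex.exp (-φ x) * h2
        exact ((hg.differentiableAt (isOpen_ball.mem_nhds hx)).hasDerivAt.mul
          ((hφ x hx).neg.cexp)).congr_deriv h3
      rw [fderivWithin_of_isOpen isOpen_ball hx]
      ext
      simpa using h1.deriv
  refine ⟨fun w => φ w + (Complex.log (g 0) - φ 0), ?_, fun w hw => ?_⟩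
  · exact hφd.add_const _
  · have := hconst w hw
    rw [Complex.exp_add, Complex.exp_sub, Complex.exp_log (hne 0 h0mem)]
    rw [Complex.exp_neg, Complex.exp_neg] at this
    have h1 := Complex.exp_ne_zero (φ w)
    have h2 := Complex.exp_ne_zero (φ 0)
    field_simp at this ⊢
    linear_combination this

open Metric Set in
/-- A nonvanishing function bounded by one is bounded below in terms of one of its values. -/
theorem harnack_of_ne_zero {g : ℂ → ℂ} {L : ℝ} (hg : DifferentiableOn ℂ g (ball 0 (1 / 2)))
    (hne : ∀ w ∈ ball (0 : ℂ) (1 / 2), g w ≠ 0) (hle : ∀ w ∈ ball (0 : ℂ) (1 / 2), ‖g w‖ ≤ 1)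
    {z w : ℂ} (hz : ‖z‖ ≤ 2 / 5) (hw : ‖w‖ ≤ 2 / 5) (hL : Real.exp (-L) ≤ ‖g w‖) :
    Real.exp (-(81 * L)) ≤ ‖g z‖ := by
  obtain ⟨φ, hφ, he⟩ := exists_log_of_ne_zero (by norm_num) hg hne
  have hn : ∀ x ∈ ball (0 : ℂ) (1 / 2), ‖g x‖ = Real.exp (φ x).re := fun x hx => by
    rw [he x hx, Complex.norm_exp]
  have hmem : ∀ x : ℂ, ‖x‖ ≤ 2 / 5 → x ∈ ball (0 : ℂ) (1 / 2) := fun x hx => by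
    rw [mem_ball_zero_iff]; linarith
  have := harnack_re (f := fun x => -φ x) hφ.neg (fun x hx => by
    have := hle x hx
    rw [hn x hx, Real.exp_le_one_iff] at this
    simpa using this) hz hw
  rw [hn w (hmem w hw), Real.exp_le_exp] at hL
  rw [hn z (hmem z hz), Real.exp_le_exp]
  simp only [Complex.neg_re] at this
  linarith

/-- The Blaschke factor of the unit disc with zero `z`. -/
def blaschke (z w : ℂ) : ℂ := (w - z) / (1 - (starRingEnd ℂ) z * w)

theorem one_sub_conj_mul_ne_zero {z w : ℂ} (hz : ‖z‖ ≤ 1 / 2) (hw : ‖w‖ < 2) :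
    1 - (starRingEnd ℂ) z * w ≠ 0 := by
  intro h
  have h1 : ‖(starRingEnd ℂ) z * w‖ = 1 := by
    rw [← sub_eq_zero.1 h]; simp
  rw [norm_mul, RCLike.norm_conj] at h1
  nlinarith [norm_nonneg z, norm_nonneg w]

theorem sq_norm_one_sub_sub_sq_norm (z w : ℂ) :
    ‖1 - (starRingEnd ℂ) z * w‖ ^ 2 - ‖w - z‖ ^ 2 = (1 - ‖w‖ ^ 2) * (1 - ‖z‖ ^ 2) := by
  simp only [Complex.sq_norm, Complex.normSq_apply, Complex.sub_re, Complex.sub_im,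
    Complex.mul_re, Complex.mul_im, Complex.conj_re, Complex.conj_im, Complex.one_re,
    Complex.one_im]
  ring

theorem norm_blaschke_le {z w : ℂ} (hz : ‖z‖ ≤ 1 / 2) (hw : ‖w‖ ≤ 2 / 5) :
    ‖blaschke z w‖ ≤ 3 / 4 := by
  have hne := one_sub_conj_mul_ne_zero hz (w := w) (by linarith)
  rw [blaschke, norm_div, div_le_iff₀ (norm_pos_iff.2 hne),
    ← sq_le_sq₀ (norm_nonneg _) (by positivity), mul_pow]
  have h1 := sq_norm_one_sub_sub_sq_norm z w
  have h2 : ‖1 - (starRingEnd ℂ) z * w‖ ≤ 6 / 5 := by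
    refine (norm_sub_le _ _).trans ?_
    rw [norm_mul, RCLike.norm_conj, norm_one]
    nlinarith [norm_nonneg z, norm_nonneg w]
  have h3 : ‖1 - (starRingEnd ℂ) z * w‖ ^ 2 ≤ (6 / 5) ^ 2 :=
    pow_le_pow_left₀ (norm_nonneg _) h2 2
  have h4 : ‖w‖ ^ 2 ≤ (2 / 5) ^ 2 := pow_le_pow_left₀ (norm_nonneg _) hw 2
  have h5 : ‖z‖ ^ 2 ≤ (1 / 2) ^ 2 := pow_le_pow_left₀ (norm_nonneg _) hz 2
  have h6 : (21 / 25) * (3 / 4) ≤ (1 - ‖w‖ ^ 2) * (1 - ‖z‖ ^ 2) := by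
    apply mul_le_mul <;> nlinarith
  nlinarith

theorem norm_sub_le_norm_blaschke {z w : ℂ} (hz : ‖z‖ ≤ 1 / 2) (hw : ‖w‖ ≤ 2 / 5) :
    ‖w - z‖ ≤ 2 * ‖blaschke z w‖ := by
  have hne := one_sub_conj_mul_ne_zero hz (w := w) (by linarith)
  rw [blaschke, norm_div, mul_div_assoc', le_div_iff₀ (norm_pos_iff.2 hne)]
  have h2 : ‖1 - (starRingEnd ℂ) z * w‖ ≤ 2 := by
    refine (norm_sub_le _ _).trans ?_
    rw [norm_mul, RCLike.norm_conj, norm_one]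
    nlinarith [norm_nonneg z, norm_nonneg w]
  nlinarith [norm_nonneg (w - z)]

open Metric Set in
/-- Dividing out a zero by a Blaschke factor keeps the bound on the unit disc. -/
theorem exists_eq_blaschke_mul {f : ℂ → ℂ} {R : ℝ} (hR1 : 1 < R) (hR2 : R < 2)
    (hf : DifferentiableOn ℂ f (ball 0 R)) (hle : ∀ w ∈ closedBall (0 : ℂ) 1, ‖f w‖ ≤ 1)
    {z : ℂ} (hz : ‖z‖ ≤ 1 / 2) (hfz : f z = 0) :
    ∃ g : ℂ → ℂ, DifferentiableOn ℂ g (ball 0 R) ∧ (∀ w ∈ closedBall (0 : ℂ) 1, ‖g w‖ ≤ 1) ∧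
      ∀ w ∈ ball (0 : ℂ) R, f w = blaschke z w * g w := by
  have hzmem : z ∈ ball (0 : ℂ) R := by rw [mem_ball_zero_iff]; linarith
  set g : ℂ → ℂ := fun w => dslope f z w * (1 - (starRingEnd ℂ) z * w) with hgdef
  have hg : DifferentiableOn ℂ g (ball 0 R) :=
    ((Complex.differentiableOn_dslope (isOpen_ball.mem_nhds hzmem)).2 hf).mul (by fun_prop)
  have hfac : ∀ w, f w = (w - z) * dslope f z w := fun w => by
    have := sub_smul_dslope f z w
    rw [hfz, sub_zero, smul_eq_mul] at this
    exact this.symm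
  refine ⟨g, hg, ?_, ?_⟩
  · have hcl : closure (ball (0 : ℂ) 1) = closedBall 0 1 := closure_ball _ one_ne_zero
    have hsub : closedBall (0 : ℂ) 1 ⊆ ball 0 R := closedBall_subset_ball hR1
    intro w hw
    refine Complex.norm_le_of_forall_mem_frontier_norm_le (U := ball 0 1) isBounded_ball
      (DifferentiableOn.diffContOnCl (hg.mono (by rw [hcl]; exact hsub))) (fun x hx => ?_)
      (by rwa [hcl])
    rw [frontier_ball _ one_ne_zero, mem_sphere_zero_iff_norm] at hx
    have h1 := sq_norm_one_sub_sub_sq_norm z x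
    rw [hx, one_pow, sub_self, zero_mul, sub_eq_zero] at h1
    have h2 := (sq_eq_sq₀ (norm_nonneg _) (norm_nonneg _)).1 h1
    rw [hgdef]
    simp only [norm_mul]
    rw [h2, mul_comm, ← norm_mul, ← hfac]
    exact hle x (by rw [mem_closedBall_zero_iff, hx])
  · intro w hw
    have hne := one_sub_conj_mul_ne_zero hz (w := w) (by rw [mem_ball_zero_iff] at hw; linarith)
    rw [hgdef, blaschke, hfac w, div_mul_eq_mul_div, eq_div_iff hne]
    ring

open Metric Set in
/-- Removing the finitely many zeros in the disc of radius `1 / 2`. -/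
theorem exists_blaschke_factorization {R : ℝ} (hR1 : 1 < R) (hR2 : R < 2)
    {w₀ : ℂ} (hw₀ : ‖w₀‖ ≤ 2 / 5) (d : ℕ) :
    ∀ {f : ℂ → ℂ}, DifferentiableOn ℂ f (ball 0 R) → (∀ w ∈ closedBall (0 : ℂ) 1, ‖f w‖ ≤ 1) →
    (3 / 4 : ℝ) ^ d < ‖f w₀‖ →
    ∃ (Z : Multiset ℂ) (g : ℂ → ℂ), (∀ z ∈ Z, ‖z‖ ≤ 1 / 2) ∧ ‖f w₀‖ ≤ (3 / 4 : ℝ) ^ Z.card ∧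
      DifferentiableOn ℂ g (ball 0 R) ∧ (∀ w ∈ closedBall (0 : ℂ) 1, ‖g w‖ ≤ 1) ∧
      (∀ w ∈ ball (0 : ℂ) (1 / 2), g w ≠ 0) ∧ ‖f w₀‖ ≤ ‖g w₀‖ ∧
      ∀ w ∈ ball (0 : ℂ) R, f w = (Z.map fun z => blaschke z w).prod * g w := by
  have hw₀1 : w₀ ∈ closedBall (0 : ℂ) 1 := by rw [mem_closedBall_zero_iff]; linarith
  have hw₀R : w₀ ∈ ball (0 : ℂ) R := by rw [mem_ball_zero_iff]; linarith
  induction d with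
  | zero =>
    intro f _ hle h
    rw [pow_zero] at h
    exact absurd (hle w₀ hw₀1) (not_le.2 h)
  | succ d ih =>
    intro f hf hle h
    by_cases hz : ∀ w ∈ ball (0 : ℂ) (1 / 2), f w ≠ 0
    · exact ⟨0, f, by simp, by simpa using hle w₀ hw₀1, hf, hle, hz, le_rfl, by simp⟩
    · push Not at hz
      obtain ⟨z, hz, hfz⟩ := hz
      have hz' : ‖z‖ ≤ 1 / 2 := (mem_ball_zero_iff.1 hz).le
      obtain ⟨g, hg, hgle, hfg⟩ := exists_eq_blaschke_mul hR1 hR2 hf hle hz' hfz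
      have hb := norm_blaschke_le hz' hw₀
      have hfw : ‖f w₀‖ ≤ 3 / 4 * ‖g w₀‖ := by
        rw [hfg w₀ hw₀R, norm_mul]
        exact mul_le_mul_of_nonneg_right hb (norm_nonneg _)
      have hgw : (3 / 4 : ℝ) ^ d < ‖g w₀‖ := by
        rw [pow_succ] at h; linarith
      obtain ⟨Z, g', h1, h2, h3, h4, h5, h6, h7⟩ := ih hg hgle hgw
      refine ⟨z ::ₘ Z, g', ?_, ?_, h3, h4, h5, ?_, ?_⟩
      · simpa using ⟨by simpa using hz', by simpa using h1⟩
      · rw [Multiset.card_cons, pow_succ]; linarith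
      · linarith [norm_nonneg (g w₀)]
      · intro w hw
        rw [hfg w hw, h7 w hw, Multiset.map_cons, Multiset.prod_cons, mul_assoc]

/-- The singularity `u ^ (-1 / 2)` on `(0, 1]`, extended by zero. -/
def rsqrtBump (u : ℝ) : ENNReal :=
  (Set.Ioc (0 : ℝ) 1).indicator (fun u => ENNReal.ofReal (u ^ (-(1 / 2) : ℝ))) u

theorem measurable_rsqrtBump : Measurable rsqrtBump :=
  Measurable.indicator (by fun_prop) measurableSet_Ioc

theorem lintegral_rsqrtBump : ∫⁻ u, rsqrtBump u = 2 := by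
  unfold rsqrtBump
  rw [lintegral_indicator measurableSet_Ioc]
  have hi : IntervalIntegrable (fun u : ℝ => u ^ (-(1 / 2) : ℝ)) volume 0 1 :=
    intervalIntegral.intervalIntegrable_rpow' (by norm_num)
  have hi' : IntegrableOn (fun u : ℝ => u ^ (-(1 / 2) : ℝ)) (Set.Ioc 0 1) :=
    (intervalIntegrable_iff_integrableOn_Ioc_of_le zero_le_one).1 hi
  rw [← ofReal_integral_eq_lintegral_ofReal hi', ← intervalIntegral.integral_of_le zero_le_one,
    integral_rpow (Or.inl (by norm_num))]
  · norm_num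
  · filter_upwards [ae_restrict_mem measurableSet_Ioc] with u hu
    exact Real.rpow_nonneg hu.1.le _

/-- A majorant on `[0, 1]` of `|t - a| ^ (-1 / 2)`. -/
def rsqrtMajorant (a t : ℝ) : ENNReal := 1 + (rsqrtBump (t - a) + rsqrtBump (a - t))

theorem measurable_rsqrtMajorant (a : ℝ) : Measurable (rsqrtMajorant a) := by
  have := measurable_rsqrtBump
  unfold rsqrtMajorant
  fun_prop

theorem setLIntegral_rsqrtMajorant_le (a : ℝ) :
    ∫⁻ t in Set.Icc (0 : ℝ) 1, rsqrtMajorant a t ≤ 5 := by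
  have hm := measurable_rsqrtBump
  unfold rsqrtMajorant
  rw [lintegral_add_left measurable_const, lintegral_add_left (by fun_prop)]
  have h1 : ∫⁻ t in Set.Icc (0 : ℝ) 1, rsqrtBump (t - a) ≤ 2 :=
    (setLIntegral_le_lintegral _ _).trans
      (by rw [lintegral_sub_right_eq_self rsqrtBump a, lintegral_rsqrtBump])
  have h2 : ∫⁻ t in Set.Icc (0 : ℝ) 1, rsqrtBump (a - t) ≤ 2 :=
    (setLIntegral_le_lintegral _ _).trans
      (by rw [lintegral_sub_left_eq_self rsqrtBump a, lintegral_rsqrtBump])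
  calc _ ≤ (1 : ENNReal) + (2 + 2) := by
        gcongr
        simp
    _ = 5 := by norm_num

theorem ofReal_rpow_le_rsqrtMajorant {a t : ℝ} (h : t ≠ a) :
    ENNReal.ofReal (|t - a| ^ (-(1 / 2) : ℝ)) ≤ rsqrtMajorant a t := by
  unfold rsqrtMajorant rsqrtBump
  rcases le_or_gt |t - a| 1 with h1 | h1
  · refine le_add_left ?_
    rcases lt_or_gt_of_ne h with h2 | h2
    · rw [abs_of_neg (by linarith), neg_sub] at h1 ⊢
      refine le_add_left ?_
      rw [Set.indicator_of_mem (by constructor <;> linarith)]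
    · rw [abs_of_pos (by linarith)] at h1 ⊢
      refine le_add_right ?_
      rw [Set.indicator_of_mem (by constructor <;> linarith)]
  · refine le_add_right ?_
    rw [← ENNReal.ofReal_one]
    exact ENNReal.ofReal_le_ofReal (Real.rpow_le_one_of_one_le_of_nonpos h1.le (by norm_num))

theorem lintegral_multiset_sum_le {α : Type*} [MeasurableSpace α] {ι : Type*} (μ : Measure α)
    {F : ι → α → ENNReal} {c : ENNReal} (hF : ∀ i, Measurable (F i)) (hc : ∀ i, ∫⁻ t, F i t ∂μ ≤ c)
    (Z : Multiset ι) :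
    Measurable (fun t => (Z.map fun i => F i t).sum) ∧
      ∫⁻ t, (Z.map fun i => F i t).sum ∂μ ≤ Z.card * c := by
  induction Z using Multiset.induction with
  | empty => simp
  | cons i Z ih =>
    simp only [Multiset.map_cons, Multiset.sum_cons, Multiset.card_cons]
    refine ⟨(hF i).add ih.1, ?_⟩
    rw [lintegral_add_left (hF i), Nat.cast_add, Nat.cast_one, add_mul, one_mul, add_comm]
    exact add_le_add ih.2 (hc i)

/-- A form of the inequality between arithmetic and geometric means. -/
theorem exp_mul_le_sum_rpow (A : ℝ) (X : Multiset ℝ) (hX : ∀ x ∈ X, 0 < x) :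
    0 < X.prod ∧ Real.exp A * (X.card * (1 - A) - 1 / 2 * Real.log X.prod) ≤
      (X.map fun x => x ^ (-(1 / 2) : ℝ)).sum := by
  induction X using Multiset.induction with
  | empty => simp
  | cons x X ih =>
    obtain ⟨h1, h2⟩ := ih fun y hy => hX y (Multiset.mem_cons_of_mem hy)
    have hx := hX x (Multiset.mem_cons_self x X)
    simp only [Multiset.map_cons, Multiset.sum_cons, Multiset.card_cons, Multiset.prod_cons]
    refine ⟨mul_pos hx h1, ?_⟩
    rw [Real.log_mul hx.ne' h1.ne', Real.rpow_def_of_pos hx]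
    have h3 := Real.add_one_le_exp (Real.log x * -(1 / 2) - A)
    have h4 : Real.exp (Real.log x * -(1 / 2)) =
        Real.exp A * Real.exp (Real.log x * -(1 / 2) - A) := by
      rw [← Real.exp_add]; congr 1; ring
    have h5 := mul_le_mul_of_nonneg_left h3 (Real.exp_pos A).le
    push_cast
    rw [h4]
    linarith

theorem ofReal_sum_rpow_le {ι : Type*} {Z : Multiset ι} {a b : ι → ℝ} {t : ℝ}
    (h : ∀ z ∈ Z, 2 / 5 * |t - a z| ≤ b z ∧ t ≠ a z) :
    ENNReal.ofReal (Z.map ((fun x : ℝ => x ^ (-(1 / 2) : ℝ)) ∘ b)).sum ≤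
      (Z.map fun z => 2 * rsqrtMajorant (a z) t).sum := by
  induction Z using Multiset.induction with
  | empty => simp
  | cons z Z ih =>
    simp only [Multiset.map_cons, Multiset.sum_cons]
    refine ENNReal.ofReal_add_le.trans
      (add_le_add ?_ (ih fun y hy => h y (Multiset.mem_cons_of_mem hy)))
    obtain ⟨h1, h2⟩ := h z (Multiset.mem_cons_self z Z)
    have h3 : 0 < |t - a z| := abs_pos.2 (sub_ne_zero.2 h2)
    calc ENNReal.ofReal (b z ^ (-(1 / 2) : ℝ))
        ≤ ENNReal.ofReal (2 * |t - a z| ^ (-(1 / 2) : ℝ)) := by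
          refine ENNReal.ofReal_le_ofReal ?_
          have h4 : (2 : ℝ) = (1 / 4 : ℝ) ^ (-(1 / 2) : ℝ) := by
            rw [show (1 / 4 : ℝ) = 2 ^ (-2 : ℝ) by norm_num, ← Real.rpow_mul (by norm_num)]
            norm_num
          have h5 : (1 / 4 * |t - a z|) ^ (-(1 / 2) : ℝ) = 2 * |t - a z| ^ (-(1 / 2) : ℝ) := by
            rw [Real.mul_rpow (by norm_num) h3.le, ← h4]
          rw [← h5]
          exact Real.rpow_le_rpow_of_nonpos (by positivity) (by linarith) (by norm_num)
      _ = 2 * ENNReal.ofReal (|t - a z| ^ (-(1 / 2) : ℝ)) := by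
          rw [ENNReal.ofReal_mul (by norm_num)]; simp
      _ ≤ 2 * rsqrtMajorant (a z) t := by
          gcongr
          exact ofReal_rpow_le_rsqrtMajorant h2

open Metric Set in
/-- **Cartan's estimate** in one variable: a function bounded by one on the disc which is not
too small at one point is small only on a set of small measure. -/
theorem volume_norm_le_exp_le {f : ℂ → ℂ} {R L σ : ℝ} (hR1 : 1 < R) (hR2 : R < 2)
    (hf : DifferentiableOn ℂ f (ball 0 R)) (hle : ∀ w ∈ closedBall (0 : ℂ) 1, ‖f w‖ ≤ 1)
    {w₀ : ℂ} (hw₀ : ‖w₀‖ ≤ 2 / 5) (hL0 : 0 < L) (hL : Real.exp (-L) ≤ ‖f w₀‖) :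
    volume {t : ℝ | t ∈ Icc (0 : ℝ) 1 ∧
        ‖f ((4 / 5 * (t - 1 / 2) : ℝ) : ℂ)‖ ≤ Real.exp (-(σ * L))} ≤
      ENNReal.ofReal (10 * Real.exp ((81 - σ) / 8)) := by
  set S := {t : ℝ | t ∈ Icc (0 : ℝ) 1 ∧
        ‖f ((4 / 5 * (t - 1 / 2) : ℝ) : ℂ)‖ ≤ Real.exp (-(σ * L))} with hS
  have hSsub : S ⊆ Icc 0 1 := fun t ht => ht.1
  rcases le_or_gt σ 81 with hσ | hσ
  · refine (measure_mono hSsub).trans ?_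
    rw [Real.volume_Icc]
    refine ENNReal.ofReal_le_ofReal ?_
    have := Real.one_le_exp (show 0 ≤ (81 - σ) / 8 by linarith)
    linarith
  have hf0 : 0 < ‖f w₀‖ := (Real.exp_pos _).trans_le hL
  obtain ⟨d, hd⟩ := exists_pow_lt_of_lt_one hf0 (show (3 / 4 : ℝ) < 1 by norm_num)
  obtain ⟨Z, g, hZ, hZc, hg, hgle, hgne, hgw, hfac⟩ :=
    exists_blaschke_factorization hR1 hR2 hw₀ d hf hle hd
  have hsub1 : ball (0 : ℂ) (1 / 2) ⊆ ball 0 R := ball_subset_ball (by linarith)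
  have hsub2 : ball (0 : ℂ) (1 / 2) ⊆ closedBall 0 1 :=
    ball_subset_closedBall.trans (closedBall_subset_closedBall (by norm_num))
  have hcard : (Z.card : ℝ) ≤ 4 * L := by
    have h1 : Real.exp (-L) ≤ Real.exp (-(Z.card / 4)) := by
      refine hL.trans (hZc.trans ?_)
      have h2 : (3 / 4 : ℝ) ≤ Real.exp (-(1 / 4)) := by
        have := Real.add_one_le_exp (-(1 / 4) : ℝ)
        linarith
      refine (pow_le_pow_left₀ (by norm_num) h2 _).trans ?_
      rw [← Real.exp_nat_mul]
      apply le_of_eq; congr 1; ring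
    rw [Real.exp_le_exp] at h1
    linarith
  set A := (σ - 81) / 8 with hA
  have hA0 : 0 < A := by rw [hA]; linarith
  set N : Set ℝ := ((Z.map fun z => 1 / 2 + 5 / 4 * z.re).toFinset : Set ℝ) with hN
  have hNnull : volume N = 0 := (Finset.finite_toSet _).measure_zero _
  have hmain : ∀ t ∈ S, t ∉ N → 0 < Z.card ∧ ENNReal.ofReal (Z.card * Real.exp A) ≤
      (Z.map fun z => 2 * rsqrtMajorant (1 / 2 + 5 / 4 * z.re) t).sum := by
    intro t ht htN
    set w : ℂ := ((4 / 5 * (t - 1 / 2) : ℝ) : ℂ) with hw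
    have hwn : ‖w‖ ≤ 2 / 5 := by
      rw [hw, Complex.norm_real, Real.norm_eq_abs, abs_le]
      constructor <;> linarith [ht.1.1, ht.1.2]
    have hgz := harnack_of_ne_zero (hg.mono hsub1) hgne (fun x hx => hgle x (hsub2 hx)) hwn hw₀
      (hL.trans hgw)
    have hb : ∀ z ∈ Z, 2 / 5 * |t - (1 / 2 + 5 / 4 * z.re)| ≤ ‖blaschke z w‖ ∧
        t ≠ 1 / 2 + 5 / 4 * z.re := by
      intro z hz
      constructor
      · have h1 := norm_sub_le_norm_blaschke (hZ z hz) hwn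
        have h2 := Complex.abs_re_le_norm (w - z)
        rw [Complex.sub_re, hw, Complex.ofReal_re] at h2
        have h3 : 4 / 5 * (t - 1 / 2) - z.re = 4 / 5 * (t - (1 / 2 + 5 / 4 * z.re)) := by ring
        rw [h3, abs_mul, abs_of_pos (by norm_num : (0 : ℝ) < 4 / 5)] at h2
        linarith
      · rintro rfl
        apply htN
        rw [hN]
        simp only [Multiset.mem_toFinset, Finset.mem_coe]
        exact Multiset.mem_map_of_mem _ hz
    have hbpos : ∀ x ∈ Z.map (fun z => ‖blaschke z w‖), 0 < x := by
      intro x hx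
      obtain ⟨z, hz, rfl⟩ := Multiset.mem_map.1 hx
      have := abs_pos.2 (sub_ne_zero.2 (hb z hz).2)
      linarith [(hb z hz).1]
    obtain ⟨hp, hAG⟩ := exp_mul_le_sum_rpow A _ hbpos
    have hprod : (Z.map fun z => ‖blaschke z w‖).prod ≤ Real.exp (-((σ - 81) * L)) := by
      have h1 := ht.2
      rw [hfac w (by rw [mem_ball_zero_iff]; linarith), norm_mul] at h1
      have h2 : ‖(Z.map fun z => blaschke z w).prod‖ = (Z.map fun z => ‖blaschke z w‖).prod := by
        rw [← coe_nnnorm, ← nnnormHom_apply, map_multiset_prod]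
        rw [← NNReal.coe_toRealHom, map_multiset_prod, Multiset.map_map, Multiset.map_map]
        rfl
      rw [h2] at h1
      have h3 : Real.exp (-((σ - 81) * L)) * Real.exp (-(81 * L)) = Real.exp (-(σ * L)) := by
        rw [← Real.exp_add]; congr 1; ring
      rw [← h3] at h1
      exact le_of_mul_le_mul_right ((mul_le_mul_of_nonneg_left hgz hp.le).trans h1)
        (Real.exp_pos _)
    have hlog : Real.log (Z.map fun z => ‖blaschke z w‖).prod ≤ -((σ - 81) * L) := by
      rw [← Real.log_exp (-((σ - 81) * L))]
      exact Real.log_le_log hp hprod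
    constructor
    · by_contra! hc
      have hZ0 : Z = 0 := by
        rw [← Multiset.card_eq_zero]; omega
      rw [hZ0] at hprod
      simp only [Multiset.map_zero, Multiset.prod_zero, Real.one_le_exp_iff] at hprod
      nlinarith
    · have h1 : Z.card * Real.exp A ≤ ((Z.map fun z => ‖blaschke z w‖).map
          fun x => x ^ (-(1 / 2) : ℝ)).sum := by
        refine le_trans ?_ hAG
        rw [Multiset.card_map, mul_comm]
        refine mul_le_mul_of_nonneg_left ?_ (Real.exp_pos A).le
        rw [hA]
        nlinarith
      refine (ENNReal.ofReal_le_ofReal h1).trans ?_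
      rw [Multiset.map_map]
      exact ofReal_sum_rpow_le hb
  have hsum := lintegral_multiset_sum_le (volume.restrict (Icc (0 : ℝ) 1))
    (F := fun (z : ℂ) t => 2 * rsqrtMajorant (1 / 2 + 5 / 4 * z.re) t) (c := 10)
    (fun z => (measurable_rsqrtMajorant _).const_mul _) (fun z => by
      rw [lintegral_const_mul _ (measurable_rsqrtMajorant _)]
      calc _ ≤ (2 : ENNReal) * 5 := by gcongr; exact setLIntegral_rsqrtMajorant_le _
        _ = 10 := by norm_num) Z
  rcases eq_or_ne (volume (S \ N)) 0 with h0 | h0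
  · have h1 : volume S ≤ volume (S \ N) + volume N := 
      (measure_mono (by intro x hx; by_cases h : x ∈ N <;> simp [h, hx])).trans
        (measure_union_le (S \ N) N)
    rw [h0, hNnull, add_zero] at h1
    exact h1.trans zero_le
  have hZpos : 0 < Z.card := by
    obtain ⟨t, ht⟩ := nonempty_of_measure_ne_zero h0
    exact (hmain t ht.1 ht.2).1
  have hmk := mul_meas_ge_le_lintegral (μ := volume.restrict (Icc (0 : ℝ) 1)) hsum.1
    (ENNReal.ofReal (Z.card * Real.exp A))
  have hSN : volume S ≤ volume.restrict (Icc (0 : ℝ) 1)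
      {t | ENNReal.ofReal (Z.card * Real.exp A) ≤
        (Z.map fun z => 2 * rsqrtMajorant (1 / 2 + 5 / 4 * z.re) t).sum} := by
    have h1 : volume S ≤ volume (S \ N) + volume N := 
      (measure_mono (by intro x hx; by_cases h : x ∈ N <;> simp [h, hx])).trans
        (measure_union_le (S \ N) N)
    rw [hNnull, add_zero] at h1
    refine h1.trans ?_
    rw [Measure.restrict_apply (measurableSet_le measurable_const hsum.1)]
    exact measure_mono fun t ht => ⟨(hmain t ht.1 ht.2).2, ht.1.1⟩
  have hfin := (mul_le_mul_right hSN (ENNReal.ofReal (Z.card * Real.exp A))).trans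
    (hmk.trans hsum.2)
  have hZr : (0 : ℝ) < Z.card := by exact_mod_cast hZpos
  have hpos : 0 < Z.card * Real.exp A := by positivity
  have h10 : (Z.card * 10 : ENNReal) = ENNReal.ofReal (Z.card * Real.exp A) *
      ENNReal.ofReal (10 * Real.exp ((81 - σ) / 8)) := by
    rw [← ENNReal.ofReal_mul hpos.le]
    have : Z.card * Real.exp A * (10 * Real.exp ((81 - σ) / 8)) = (Z.card * 10 : ℕ) := by
      have h2 : Real.exp A * Real.exp ((81 - σ) / 8) = 1 := by
        rw [← Real.exp_add, hA, Real.exp_eq_one_iff]; ring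
      push_cast
      linear_combination (Z.card * 10 : ℝ) * h2
    rw [this, ENNReal.ofReal_natCast]
    push_cast
    rfl
  rw [h10] at hfin
  exact (ENNReal.mul_le_mul_iff_right (ENNReal.ofReal_pos.2 hpos).ne'
    ENNReal.ofReal_ne_top).1 hfin

section EuclideanNorm

variable {ι κ : Type*} [Fintype ι] [Fintype κ]

/-- The Euclidean norm of a complex vector. -/
def euclNorm (v : ι → ℂ) : ℝ := ‖WithLp.toLp 2 v‖

theorem euclNorm_nonneg (v : ι → ℂ) : 0 ≤ euclNorm v := norm_nonneg _

theorem euclNorm_add_le (v w : ι → ℂ) : euclNorm (v + w) ≤ euclNorm v + euclNorm w :=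
  norm_add_le (WithLp.toLp 2 v) (WithLp.toLp 2 w)

theorem euclNorm_neg (v : ι → ℂ) : euclNorm (-v) = euclNorm v :=
  norm_neg (WithLp.toLp 2 v)

theorem euclNorm_smul (c : ℂ) (v : ι → ℂ) : euclNorm (c • v) = ‖c‖ * euclNorm v :=
  norm_smul c (WithLp.toLp 2 v)

theorem euclNorm_zero : euclNorm (0 : ι → ℂ) = 0 := by simp [euclNorm]

theorem euclNorm_pos {v : ι → ℂ} (h : v ≠ 0) : 0 < euclNorm v := by
  unfold euclNorm
  simpa using h

theorem euclNorm_sq (v : ι → ℂ) : euclNorm v ^ 2 = ∑ i, ‖v i‖ ^ 2 := by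
  simp [euclNorm, EuclideanSpace.norm_sq_eq]

theorem euclNorm_comp_equiv (v : ι → ℂ) (e : κ ≃ ι) : euclNorm (v ∘ e) = euclNorm v := by
  rw [← sq_eq_sq₀ (euclNorm_nonneg _) (euclNorm_nonneg _), euclNorm_sq, euclNorm_sq]
  exact e.sum_comp fun i => ‖v i‖ ^ 2

theorem euclNorm_sumElim_sq (x : ι → ℂ) (y : κ → ℂ) :
    euclNorm (Sum.elim x y) ^ 2 = euclNorm x ^ 2 + euclNorm y ^ 2 := by
  simp [euclNorm_sq]

theorem euclNorm_le_sumElim_left (x : ι → ℂ) (y : κ → ℂ) :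
    euclNorm x ≤ euclNorm (Sum.elim x y) := by
  rw [← sq_le_sq₀ (euclNorm_nonneg _) (euclNorm_nonneg _), euclNorm_sumElim_sq]
  nlinarith [sq_nonneg (euclNorm y)]

theorem euclNorm_le_sumElim_right (x : ι → ℂ) (y : κ → ℂ) :
    euclNorm y ≤ euclNorm (Sum.elim x y) := by
  rw [← sq_le_sq₀ (euclNorm_nonneg _) (euclNorm_nonneg _), euclNorm_sumElim_sq]
  nlinarith [sq_nonneg (euclNorm x)]

theorem euclNorm_sumElim_le (x : ι → ℂ) (y : κ → ℂ) :
    euclNorm (Sum.elim x y) ≤ euclNorm x + euclNorm y := by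
  have hx := euclNorm_nonneg x
  have hy := euclNorm_nonneg y
  rw [← sq_le_sq₀ (euclNorm_nonneg _) (by positivity), euclNorm_sumElim_sq]
  nlinarith

theorem norm_star_dotProduct_le (x y : ι → ℂ) : ‖star x ⬝ᵥ y‖ ≤ euclNorm x * euclNorm y := by
  have := norm_inner_le_norm (𝕜 := ℂ) (WithLp.toLp 2 x) (WithLp.toLp 2 y)
  rwa [EuclideanSpace.inner_toLp_toLp, dotProduct_comm] at this

theorem star_dotProduct_self (x : ι → ℂ) : star x ⬝ᵥ x = ((euclNorm x ^ 2 : ℝ) : ℂ) := by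
  rw [euclNorm_sq, dotProduct]
  push_cast
  exact Finset.sum_congr rfl fun i _ => by
    simpa [Complex.normSq_eq_norm_sq] using (Complex.normSq_eq_conj_mul_self (z := x i)).symm

theorem euclNorm_mulVec_le [DecidableEq ι] (M : Matrix ι ι ℂ) (v : ι → ℂ) :
    euclNorm (M.mulVec v) ≤ opNorm M * euclNorm v :=
  (Matrix.toEuclideanCLM (𝕜 := ℂ) M).le_opNorm (WithLp.toLp 2 v)

theorem opNorm_le_of_euclNorm_le [DecidableEq ι] {M : Matrix ι ι ℂ} {c : ℝ} (hc : 0 ≤ c)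
    (h : ∀ v, euclNorm (M.mulVec v) ≤ c * euclNorm v) : opNorm M ≤ c :=
  ContinuousLinearMap.opNorm_le_bound _ hc fun v => h (WithLp.ofLp v)

theorem euclNorm_le_of_opNorm_inv_le [DecidableEq ι] {M : Matrix ι ι ℂ} {c : ℝ} (hM : IsUnit M)
    (h : opNorm M⁻¹ ≤ c) (v : ι → ℂ) : euclNorm v ≤ c * euclNorm (M.mulVec v) := by
  have h1 := euclNorm_mulVec_le M⁻¹ (M.mulVec v)
  rw [Matrix.mulVec_mulVec, Matrix.nonsing_inv_mul _ ((Matrix.isUnit_iff_isUnit_det _).1 hM),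
    Matrix.one_mulVec] at h1
  exact h1.trans (mul_le_mul_of_nonneg_right h (euclNorm_nonneg _))

theorem isUnit_and_opNorm_inv_le [DecidableEq ι] {M : Matrix ι ι ℂ} {c : ℝ} (hc : 0 ≤ c)
    (h : ∀ v, euclNorm v ≤ c * euclNorm (M.mulVec v)) : IsUnit M ∧ opNorm M⁻¹ ≤ c := by
  have hu : IsUnit M := by
    rw [Matrix.isUnit_iff_isUnit_det, isUnit_iff_ne_zero]
    intro h0
    obtain ⟨v, hv, hv0⟩ := Matrix.exists_mulVec_eq_zero_iff.2 h0
    have := h v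
    rw [hv0, euclNorm_zero, mul_zero] at this
    exact absurd (euclNorm_pos hv) (not_lt.2 this)
  refine ⟨hu, opNorm_le_of_euclNorm_le hc fun v => ?_⟩
  have h1 := h (M⁻¹.mulVec v)
  rwa [Matrix.mulVec_mulVec, Matrix.mul_nonsing_inv _ ((Matrix.isUnit_iff_isUnit_det _).1 hu),
    Matrix.one_mulVec] at h1

theorem exists_eigenvector_of_mem_roots [DecidableEq ι] {S : Matrix ι ι ℂ} {r : ℂ}
    (hr : r ∈ S.charpoly.roots) : ∃ v ≠ 0, S.mulVec v = r • v := by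
  have h0 : (Matrix.scalar ι r - S).det = 0 := by
    rw [← Matrix.eval_charpoly]
    exact (Polynomial.mem_roots'.1 hr).2
  obtain ⟨v, hv, h⟩ := Matrix.exists_mulVec_eq_zero_iff.2 h0
  refine ⟨v, hv, ?_⟩
  rw [Matrix.sub_mulVec, sub_eq_zero] at h
  rw [← h]
  ext i
  simp [Matrix.scalar_apply, Matrix.mulVec_diagonal]

theorem card_roots_charpoly [DecidableEq ι] (S : Matrix ι ι ℂ) :
    S.charpoly.roots.card = Fintype.card ι := by
  rw [← (IsAlgClosed.splits S.charpoly).natDegree_eq_card_roots, Matrix.charpoly_natDegree_eq_dim]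

theorem norm_det_le_pow [DecidableEq ι] {S : Matrix ι ι ℂ} {s : ℝ}
    (h : ∀ v, euclNorm (S.mulVec v) ≤ s * euclNorm v) : ‖S.det‖ ≤ s ^ Fintype.card ι := by
  rw [Matrix.det_eq_prod_roots_charpoly, ← card_roots_charpoly S]
  have hr : ∀ r ∈ S.charpoly.roots, ‖r‖ ≤ s := fun r hr => by
    obtain ⟨v, hv, hvr⟩ := exists_eigenvector_of_mem_roots hr
    have := h v
    rw [hvr, euclNorm_smul] at this
    exact le_of_mul_le_mul_right this (euclNorm_pos hv)
  generalize S.charpoly.roots = Z at hr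
  induction Z using Multiset.induction with
  | empty => simp
  | cons r Z ih =>
    rw [Multiset.prod_cons, norm_mul, Multiset.card_cons, pow_succ']
    have h1 := hr r (Multiset.mem_cons_self r Z)
    exact mul_le_mul h1 (ih fun q hq => hr q (Multiset.mem_cons_of_mem hq)) (norm_nonneg _)
      ((norm_nonneg _).trans h1)

theorem pow_le_norm_det [DecidableEq ι] {S : Matrix ι ι ℂ} {s : ℝ} (hs : 0 ≤ s)
    (h : ∀ v, s * euclNorm v ≤ euclNorm (S.mulVec v)) : s ^ Fintype.card ι ≤ ‖S.det‖ := by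
  rw [Matrix.det_eq_prod_roots_charpoly, ← card_roots_charpoly S]
  have hr : ∀ r ∈ S.charpoly.roots, s ≤ ‖r‖ := fun r hr => by
    obtain ⟨v, hv, hvr⟩ := exists_eigenvector_of_mem_roots hr
    have := h v
    rw [hvr, euclNorm_smul] at this
    exact le_of_mul_le_mul_right this (euclNorm_pos hv)
  generalize S.charpoly.roots = Z at hr
  induction Z using Multiset.induction with
  | empty => simp
  | cons r Z ih =>
    rw [Multiset.prod_cons, norm_mul, Multiset.card_cons, pow_succ']
    exact mul_le_mul (hr r (Multiset.mem_cons_self r Z))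
      (ih fun q hq => hr q (Multiset.mem_cons_of_mem hq)) (by positivity) (norm_nonneg _)

/-- If `S` nearly annihilates a vector, its determinant is small. -/
theorem norm_det_le_of_euclNorm_mulVec_le [DecidableEq ι] {S : Matrix ι ι ℂ} {s ε : ℝ}
    (hs : 1 ≤ s) (hε : 0 < ε) (h : ∀ v, euclNorm (S.mulVec v) ≤ s * euclNorm v)
    {x : ι → ℂ} (hx : x ≠ 0) (hSx : euclNorm (S.mulVec x) ≤ ε * euclNorm x) :
    ‖S.det‖ ≤ (2 * s) ^ Fintype.card ι * ε := by
  rcases le_or_gt s ε with hsε | hsε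
  · have h1 := norm_det_le_pow h
    have h2 : s ^ Fintype.card ι ≤ (2 * s) ^ Fintype.card ι :=
      pow_le_pow_left₀ (by linarith) (by linarith) _
    have h3 : (0 : ℝ) ≤ (2 * s) ^ Fintype.card ι := by positivity
    nlinarith
  have hxp := euclNorm_pos hx
  set a : ℂ := (((s / ε - 1) / euclNorm x ^ 2 : ℝ) : ℂ) with ha
  set P : Matrix ι ι ℂ := 1 + Matrix.replicateCol Unit (a • x) * Matrix.replicateRow Unit (star x)
    with hP
  have hPdet : P.det = ((s / ε : ℝ) : ℂ) := by
    rw [hP, Matrix.det_one_add_replicateCol_mul_replicateRow, dotProduct_smul,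
      star_dotProduct_self, ha, smul_eq_mul, ← Complex.ofReal_mul,
      div_mul_cancel₀ _ (by positivity)]
    push_cast
    ring
  have hPv : ∀ v, P.mulVec v = v + (star x ⬝ᵥ v) • a • x := by
    intro v
    rw [hP, Matrix.add_mulVec, Matrix.one_mulVec, ← Matrix.mulVec_mulVec]
    congr 1
    ext i
    simp [Matrix.mulVec, dotProduct, mul_comm]
  have hbound : ∀ v, euclNorm ((S * P).mulVec v) ≤ (2 * s) * euclNorm v := by
    intro v
    have hv := euclNorm_nonneg v
    rw [← Matrix.mulVec_mulVec, hPv, Matrix.mulVec_add, Matrix.mulVec_smul, Matrix.mulVec_smul]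
    refine (euclNorm_add_le _ _).trans ?_
    rw [euclNorm_smul, euclNorm_smul]
    have h1 : ‖a‖ = (s / ε - 1) / euclNorm x ^ 2 := by
      rw [ha, Complex.norm_real, Real.norm_eq_abs, abs_of_nonneg]
      refine div_nonneg ?_ (by positivity)
      rw [sub_nonneg, one_le_div hε]
      exact hsε.le
    have h2 : ‖star x ⬝ᵥ v‖ * (‖a‖ * euclNorm (S.mulVec x)) ≤
        (euclNorm x * euclNorm v) * (‖a‖ * (ε * euclNorm x)) := by
      exact mul_le_mul (norm_star_dotProduct_le x v)
        (mul_le_mul_of_nonneg_left hSx (norm_nonneg a))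
        (mul_nonneg (norm_nonneg _) (euclNorm_nonneg _))
        (mul_nonneg (euclNorm_nonneg _) hv)
    have h3 : (euclNorm x * euclNorm v) * (‖a‖ * (ε * euclNorm x)) = (s - ε) * euclNorm v := by
      rw [h1]
      field_simp
    nlinarith [h v]
  have hdet := norm_det_le_pow hbound
  rw [Matrix.det_mul, norm_mul, hPdet, Complex.norm_real, Real.norm_eq_abs,
    abs_of_pos (by positivity), mul_div_assoc', div_le_iff₀ hε] at hdet
  nlinarith [norm_nonneg S.det]

end EuclideanNorm

section Schur

variable {ι κ : Type*} [Fintype ι] [Fintype κ] [DecidableEq κ]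

variable {A : Matrix ι ι ℂ} {B : Matrix ι κ ℂ} {C : Matrix κ ι ℂ} {D : Matrix κ κ ℂ} {B₁ B₂ : ℝ}

theorem det_fromBlocks_div [DecidableEq ι] (hD : IsUnit D) :
    (Matrix.fromBlocks A B C D).det / D.det = (A - B * D⁻¹ * C).det := by
  let _ := hD.invertible
  have hdet : D.det ≠ 0 := ((Matrix.isUnit_iff_isUnit_det _).1 hD).ne_zero
  rw [Matrix.det_fromBlocks₂₂, mul_div_cancel_left₀ _ hdet, Matrix.invOf_eq_nonsing_inv]

theorem fromBlocks_mulVec_sumElim (hD : IsUnit D) (x : ι → ℂ) (u : κ → ℂ) :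
    (Matrix.fromBlocks A B C D).mulVec (Sum.elim x (u - D⁻¹.mulVec (C.mulVec x))) =
      Sum.elim ((A - B * D⁻¹ * C).mulVec x + B.mulVec u) (D.mulVec u) := by
  have hdet := (Matrix.isUnit_iff_isUnit_det _).1 hD
  rw [Matrix.fromBlocks_mulVec]
  simp only [Sum.elim_comp_inl, Sum.elim_comp_inr]
  congr 1
  · rw [Matrix.sub_mulVec, Matrix.mulVec_sub, ← Matrix.mulVec_mulVec, ← Matrix.mulVec_mulVec]
    abel
  · rw [Matrix.mulVec_sub, Matrix.mulVec_mulVec _ D, Matrix.mul_nonsing_inv _ hdet,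
      Matrix.one_mulVec]
    abel

theorem euclNorm_inv_mulVec_le (hB₂ : 0 ≤ B₂) (hD : IsUnit D)
    (hM : ∀ v, euclNorm ((Matrix.fromBlocks A B C D).mulVec v) ≤ B₁ * euclNorm v)
    (hDb : ∀ y, euclNorm y ≤ B₂ * euclNorm (D.mulVec y)) (x : ι → ℂ) :
    euclNorm (D⁻¹.mulVec (C.mulVec x)) ≤ B₁ * B₂ * euclNorm x := by
  have hdet := (Matrix.isUnit_iff_isUnit_det _).1 hD
  have h1 := hDb (D⁻¹.mulVec (C.mulVec x))
  rw [Matrix.mulVec_mulVec _ D, Matrix.mul_nonsing_inv _ hdet, Matrix.one_mulVec] at h1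
  have h2 := hM (Sum.elim x 0)
  rw [Matrix.fromBlocks_mulVec] at h2
  simp only [Sum.elim_comp_inl, Sum.elim_comp_inr, Matrix.mulVec_zero, add_zero] at h2
  have h3 := (euclNorm_le_sumElim_right _ _).trans h2
  have h4 := euclNorm_sumElim_le x (0 : κ → ℂ)
  have h5 := euclNorm_le_sumElim_left x (0 : κ → ℂ)
  rw [euclNorm_zero, add_zero] at h4
  rw [le_antisymm h4 h5] at h3
  calc _ ≤ _ := h1
    _ ≤ B₂ * (B₁ * euclNorm x) := by gcongr
    _ = _ := by ring

theorem euclNorm_schur_mulVec_le (hB₁ : 1 ≤ B₁) (hB₂ : 1 ≤ B₂) (hD : IsUnit D)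
    (hM : ∀ v, euclNorm ((Matrix.fromBlocks A B C D).mulVec v) ≤ B₁ * euclNorm v)
    (hDb : ∀ y, euclNorm y ≤ B₂ * euclNorm (D.mulVec y)) (x : ι → ℂ) :
    euclNorm ((A - B * D⁻¹ * C).mulVec x) ≤ 2 * (B₁ * B₂) ^ 2 * euclNorm x := by
  have h1 := hM (Sum.elim x (0 - D⁻¹.mulVec (C.mulVec x)))
  rw [fromBlocks_mulVec_sumElim hD, Matrix.mulVec_zero, Matrix.mulVec_zero, add_zero] at h1
  have h2 := (euclNorm_le_sumElim_left _ _).trans h1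
  have h3 := euclNorm_sumElim_le x (0 - D⁻¹.mulVec (C.mulVec x))
  rw [zero_sub, euclNorm_neg] at h3
  have h4 := euclNorm_inv_mulVec_le (by linarith) hD hM hDb x
  have h5 : B₁ * euclNorm (Sum.elim x (0 - D⁻¹.mulVec (C.mulVec x))) ≤
      B₁ * (euclNorm x + B₁ * B₂ * euclNorm x) := by
    rw [zero_sub]; gcongr; linarith
  refine (h2.trans h5).trans ?_
  have hx := euclNorm_nonneg x
  have hp : B₁ ≤ B₁ * B₂ := by nlinarith
  have hp1 : B₁ * (1 + B₁ * B₂) ≤ 2 * (B₁ * B₂) ^ 2 := by nlinarith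
  nlinarith

theorem euclNorm_le_schur_mulVec {B₃ : ℝ} (hD : IsUnit D)
    (h : ∀ v, euclNorm v ≤ B₃ * euclNorm ((Matrix.fromBlocks A B C D).mulVec v)) (x : ι → ℂ) :
    euclNorm x ≤ B₃ * euclNorm ((A - B * D⁻¹ * C).mulVec x) := by
  have h1 := h (Sum.elim x (0 - D⁻¹.mulVec (C.mulVec x)))
  rw [fromBlocks_mulVec_sumElim hD, Matrix.mulVec_zero, Matrix.mulVec_zero, add_zero] at h1
  have h2 := euclNorm_sumElim_le ((A - B * D⁻¹ * C).mulVec x) (0 : κ → ℂ)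
  have h3 := euclNorm_le_sumElim_left ((A - B * D⁻¹ * C).mulVec x) (0 : κ → ℂ)
  rw [euclNorm_zero, add_zero] at h2
  rw [le_antisymm h2 h3] at h1
  exact (euclNorm_le_sumElim_left _ _).trans h1

theorem exists_schur_mulVec_le {K : ℝ} (hB₁ : 1 ≤ B₁) (hB₂ : 1 ≤ B₂) (hD : IsUnit D)
    (hM : ∀ v, euclNorm ((Matrix.fromBlocks A B C D).mulVec v) ≤ B₁ * euclNorm v)
    (hDb : ∀ y, euclNorm y ≤ B₂ * euclNorm (D.mulVec y)) (hK : 2 * B₂ ≤ K)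
    {v : ι ⊕ κ → ℂ} (hv : v ≠ 0)
    (hvK : K * euclNorm ((Matrix.fromBlocks A B C D).mulVec v) ≤ euclNorm v) :
    ∃ x ≠ 0, euclNorm ((A - B * D⁻¹ * C).mulVec x) ≤ 8 * (B₁ * B₂) ^ 2 / K * euclNorm x := by
  have hK0 : 0 < K := by linarith
  obtain ⟨x, u, rfl⟩ : ∃ x u, v = Sum.elim x (u - D⁻¹.mulVec (C.mulVec x)) :=
    ⟨v ∘ Sum.inl, v ∘ Sum.inr + D⁻¹.mulVec (C.mulVec (v ∘ Sum.inl)), by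
      rw [add_sub_cancel_right, Sum.elim_comp_inl_inr]⟩
  set S := A - B * D⁻¹ * C with hS
  set V := euclNorm (Sum.elim x (u - D⁻¹.mulVec (C.mulVec x))) with hV
  have hVpos : 0 < V := euclNorm_pos hv
  rw [fromBlocks_mulVec_sumElim hD, ← hS] at hvK
  have h1 := euclNorm_le_sumElim_left (S.mulVec x + B.mulVec u) (D.mulVec u)
  have h2 := euclNorm_le_sumElim_right (S.mulVec x + B.mulVec u) (D.mulVec u)
  set W := euclNorm (Sum.elim (S.mulVec x + B.mulVec u) (D.mulVec u)) with hW
  have hu : euclNorm u ≤ B₂ * W := (hDb u).trans (by gcongr)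
  have hW0 : 0 ≤ W := euclNorm_nonneg _
  have hu2 : euclNorm u ≤ V / 2 := by nlinarith
  have hBu : euclNorm (B.mulVec u) ≤ B₁ * euclNorm u := by
    have h3 := hM (Sum.elim 0 u)
    rw [Matrix.fromBlocks_mulVec] at h3
    simp only [Sum.elim_comp_inl, Sum.elim_comp_inr, Matrix.mulVec_zero, zero_add] at h3
    have h4 := euclNorm_sumElim_le (0 : ι → ℂ) u
    rw [euclNorm_zero, zero_add] at h4
    refine (euclNorm_le_sumElim_left _ _).trans (h3.trans ?_)
    gcongr
  have hSx : euclNorm (S.mulVec x) ≤ W + B₁ * (B₂ * W) := by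
    have h3 := euclNorm_add_le (S.mulVec x + B.mulVec u) (-(B.mulVec u))
    rw [add_neg_cancel_right, euclNorm_neg] at h3
    have h4 : B₁ * euclNorm u ≤ B₁ * (B₂ * W) := by gcongr
    linarith
  have hVx : V ≤ 4 * (B₁ * B₂) * euclNorm x := by
    have h3 := euclNorm_sumElim_le x (u - D⁻¹.mulVec (C.mulVec x))
    have h4 := euclNorm_add_le u (-(D⁻¹.mulVec (C.mulVec x)))
    rw [euclNorm_neg, ← sub_eq_add_neg] at h4
    have h5 := euclNorm_inv_mulVec_le (by linarith) hD hM hDb x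
    have h6 : 1 ≤ B₁ * B₂ := by nlinarith
    nlinarith [euclNorm_nonneg x]
  have hp : 1 ≤ B₁ * B₂ := by nlinarith
  refine ⟨x, ?_, ?_⟩
  · rintro rfl
    rw [euclNorm_zero, mul_zero] at hVx
    linarith
  · rw [div_mul_eq_mul_div, le_div_iff₀ hK0]
    have h3 : euclNorm (S.mulVec x) ≤ 2 * (B₁ * B₂) * W := by nlinarith
    calc _ ≤ 2 * (B₁ * B₂) * W * K := by gcongr
      _ = 2 * (B₁ * B₂) * (K * W) := by ring
      _ ≤ 2 * (B₁ * B₂) * (4 * (B₁ * B₂) * euclNorm x) :=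
          mul_le_mul_of_nonneg_left (hvK.trans hVx) (by positivity)
      _ = _ := by ring

end Schur

section PrincipalSubmatrix

variable {N : ℕ}

/-- The principal submatrix obtained by deleting the rows and columns indexed by `J`. -/
def complSubmatrix (M : Matrix (Fin N) (Fin N) ℂ) (J : Finset (Fin N)) :
    Matrix {i : Fin N // i ∉ J} {i : Fin N // i ∉ J} ℂ :=
  M.submatrix (fun i => (i : Fin N)) (fun i => (i : Fin N))

theorem exists_schur_complement (M : Matrix (Fin N) (Fin N) ℂ) (J : Finset (Fin N)) {B₁ B₂ : ℝ}
    (hB₁ : 1 ≤ B₁) (hB₂ : 1 ≤ B₂) (hM : ∀ v, euclNorm (M.mulVec v) ≤ B₁ * euclNorm v)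
    (hD : IsUnit (complSubmatrix M J))
    (hDb : ∀ y, euclNorm y ≤ B₂ * euclNorm ((complSubmatrix M J).mulVec y)) :
    ∃ S : Matrix {i : Fin N // i ∈ J} {i : Fin N // i ∈ J} ℂ,
      M.det / (complSubmatrix M J).det = S.det ∧
      (∀ x, euclNorm (S.mulVec x) ≤ 2 * (B₁ * B₂) ^ 2 * euclNorm x) ∧
      (∀ B₃ : ℝ, (∀ v, euclNorm v ≤ B₃ * euclNorm (M.mulVec v)) →
        ∀ x, euclNorm x ≤ B₃ * euclNorm (S.mulVec x)) ∧
      ∀ K : ℝ, 2 * B₂ ≤ K → ∀ v ≠ 0, K * euclNorm (M.mulVec v) ≤ euclNorm v →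
        ∃ x ≠ 0, euclNorm (S.mulVec x) ≤ 8 * (B₁ * B₂) ^ 2 / K * euclNorm x := by
  set e : {i : Fin N // i ∈ J} ⊕ {i : Fin N // i ∉ J} ≃ Fin N := Equiv.sumCompl (· ∈ J) with he
  set M' := M.submatrix e e with hM'
  have hblocks : Matrix.fromBlocks M'.toBlocks₁₁ M'.toBlocks₁₂ M'.toBlocks₂₁
      (complSubmatrix M J) = M' := Matrix.fromBlocks_toBlocks M'
  have hmul : ∀ v, euclNorm (M'.mulVec v) = euclNorm (M.mulVec (v ∘ e.symm)) := fun v => by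
    rw [hM', Matrix.submatrix_mulVec_equiv, euclNorm_comp_equiv]
  have hcomp : ∀ v : {i : Fin N // i ∈ J} ⊕ {i : Fin N // i ∉ J} → ℂ,
      euclNorm (v ∘ e.symm) = euclNorm v := fun v => euclNorm_comp_equiv v e.symm
  have hM1 : ∀ v, euclNorm ((Matrix.fromBlocks M'.toBlocks₁₁ M'.toBlocks₁₂ M'.toBlocks₂₁
      (complSubmatrix M J)).mulVec v) ≤ B₁ * euclNorm v := fun v => by
    rw [hblocks, hmul, ← hcomp v]
    exact hM _
  refine ⟨M'.toBlocks₁₁ - M'.toBlocks₁₂ * (complSubmatrix M J)⁻¹ * M'.toBlocks₂₁, ?_, ?_, ?_, ?_⟩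
  · rw [← det_fromBlocks_div hD, hblocks, hM', Matrix.det_submatrix_equiv_self]
  · exact euclNorm_schur_mulVec_le hB₁ hB₂ hD hM1 hDb
  · intro B₃ h
    refine euclNorm_le_schur_mulVec hD fun v => ?_
    rw [hblocks, hmul, ← hcomp v]
    exact h _
  · intro K hK v hv hvK
    refine exists_schur_mulVec_le hB₁ hB₂ hD hM1 hDb hK (v := v ∘ e) ?_ ?_
    · intro h
      apply hv
      have := congrArg (· ∘ e.symm) h
      simpa [Function.comp_assoc] using this
    · rw [hblocks, hmul, euclNorm_comp_equiv]
      simpa [Function.comp_assoc] using hvK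

end PrincipalSubmatrix

section Cube

theorem volume_preimage_homothety {n : ℕ} (p : Fin n → ℝ) {t : ℝ} (ht : 0 < t)
    (E : Set (Fin n → ℝ)) :
    volume E = ENNReal.ofReal (t ^ n) * volume {x | p + t • (x - p) ∈ E} := by
  have h := Measure.addHaar_image_homothety volume p t {x : Fin n → ℝ | p + t • (x - p) ∈ E}
  rw [Module.finrank_fin_fun, abs_of_pos (by positivity)] at h
  rw [← h]
  congr 1
  ext y
  constructor
  · intro hy
    refine ⟨p + t⁻¹ • (y - p), ?_, ?_⟩
    · simpa [smul_smul, mul_inv_cancel₀ ht.ne'] using hy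
    · simp [AffineMap.homothety_apply, smul_smul, mul_inv_cancel₀ ht.ne']
  · rintro ⟨x, hx, rfl⟩
    simpa [AffineMap.homothety_apply, add_comm] using hx

theorem volume_le_of_radial_slices {n : ℕ} (p : Fin n → ℝ) {E X : Set (Fin n → ℝ)}
    (hE : MeasurableSet E) {s : ℝ} (hs : 0 < s) {δ : ENNReal}
    (hX : ∀ x t, s ≤ t → t ≤ 1 → p + t • (x - p) ∈ E → x ∈ X)
    (hδ : ∀ x ∈ X, volume {t : ℝ | t ∈ Set.Icc (0 : ℝ) 1 ∧ p + t • (x - p) ∈ E} ≤ δ) :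
    volume E * ENNReal.ofReal (1 - s) ≤ δ * volume X := by
  set T : Set (ℝ × (Fin n → ℝ)) := {q | q.1 ∈ Set.Icc s 1 ∧ p + q.1 • (q.2 - p) ∈ E} with hT
  have hTm : MeasurableSet T := by
    refine (measurableSet_Icc.preimage measurable_fst).inter (hE.preimage ?_)
    fun_prop
  have h1 : volume E * ENNReal.ofReal (1 - s) ≤ (volume.prod volume) T := by
    rw [Measure.prod_apply hTm, ← Real.volume_Icc, ← setLIntegral_const,
      ← lintegral_indicator measurableSet_Icc]
    refine lintegral_mono fun t => ?_
    by_cases ht : t ∈ Set.Icc s 1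
    · rw [Set.indicator_of_mem ht, volume_preimage_homothety p (hs.trans_le ht.1) E]
      refine (mul_le_of_le_one_left' ?_).trans (measure_mono fun x hx => ⟨ht, hx⟩)
      exact ENNReal.ofReal_le_one.2 (pow_le_one₀ (hs.le.trans ht.1) ht.2)
    · rw [Set.indicator_of_notMem ht]
      exact zero_le
  refine h1.trans ?_
  rw [Measure.prod_apply_symm hTm]
  refine (lintegral_mono fun x => ?_).trans (lintegral_indicator_const_le X δ)
  by_cases hx : x ∈ X
  · rw [Set.indicator_of_mem hx]
    refine (measure_mono ?_).trans (hδ x hx)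
    exact fun t ht => ⟨⟨hs.le.trans ht.1.1, ht.1.2⟩, ht.2⟩
  · rw [Set.indicator_of_notMem hx]
    refine (measure_mono_null (t := ∅) (fun t ht => ?_) measure_empty).le
    exact hx (hX x t ht.1.1 ht.1.2 ht.2)

/-- The polydisc `D ^ n` concentric to the cube `[a, b] ^ n`, where `D` has radius
`(e / 2) * (b - a)`. -/
def polydisc (n : ℕ) (a b : ℝ) : Set (Fin n → ℂ) :=
  {z | ∀ k, z k ∈ Metric.ball (((a + b) / 2 : ℝ) : ℂ) (Real.exp 1 / 2 * (b - a))}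

theorem line_mem_polydisc {n : ℕ} {a b η : ℝ} (hab : a < b) (hη0 : 0 ≤ η) (hη : η ≤ 1 / 100)
    {p x : Fin n → ℝ} (hp : ∀ k, p k ∈ Set.Icc a b) (hx : ∀ k, x k ∈ Set.Icc a b) {w : ℂ}
    (hw : ‖w‖ < 21 / 20) :
    (fun k => (p k : ℂ) + (1 / 2 + 5 / 4 * w) * (((1 + η) * (x k - p k) : ℝ) : ℂ)) ∈
      polydisc n a b := by
  intro k
  have he := Real.exp_one_gt_d9
  rw [mem_ball_iff_norm]
  have hrw : (p k : ℂ) + (1 / 2 + 5 / 4 * w) * (((1 + η) * (x k - p k) : ℝ) : ℂ) -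
      (((a + b) / 2 : ℝ) : ℂ) = (((p k + x k - (a + b)) / 2 : ℝ) : ℂ) +
      (((η / 2 : ℝ) : ℂ) + ((5 / 4 * (1 + η) : ℝ) : ℂ) * w) * ((x k - p k : ℝ) : ℂ) := by
    push_cast
    ring
  have h1 : ‖((η / 2 : ℝ) : ℂ) + ((5 / 4 * (1 + η) : ℝ) : ℂ) * w‖ ≤ 1.34 := by
    refine (norm_add_le _ _).trans ?_
    rw [norm_mul, Complex.norm_real, Complex.norm_real, Real.norm_eq_abs, Real.norm_eq_abs,
      abs_of_nonneg (by positivity), abs_of_nonneg (by positivity)]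
    have h2 : 5 / 4 * (1 + η) * ‖w‖ ≤ 5 / 4 * (1 + 1 / 100) * (21 / 20) := by gcongr
    norm_num at h2 ⊢
    linarith
  rw [hrw]
  refine (norm_add_le _ _).trans_lt ?_
  rw [norm_mul, Complex.norm_real, Complex.norm_real, Real.norm_eq_abs, Real.norm_eq_abs]
  have h2 : ‖((η / 2 : ℝ) : ℂ) + ((5 / 4 * (1 + η) : ℝ) : ℂ) * w‖ * |x k - p k| ≤
      1.34 * |x k - p k| := by gcongr
  obtain ⟨hp1, hp2⟩ := hp k
  obtain ⟨hx1, hx2⟩ := hx k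
  have h3 : |(p k + x k - (a + b)) / 2| + 1.34 * |x k - p k| ≤ 1.34 * (b - a) := by
    rcases abs_cases ((p k + x k - (a + b)) / 2) with h | h <;>
    rcases abs_cases (x k - p k) with h' | h' <;> norm_num <;> linarith
  have h4 : 1.34 * (b - a) < Real.exp 1 / 2 * (b - a) := by
    apply mul_lt_mul_of_pos_right _ (by linarith)
    norm_num at he ⊢
    linarith
  linarith

theorem real_mem_polydisc {n : ℕ} {a b : ℝ} (hab : a < b) {x : Fin n → ℝ}
    (hx : ∀ k, x k ∈ Set.Icc a b) : (fun k => (x k : ℂ)) ∈ polydisc n a b := by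
  have := line_mem_polydisc hab le_rfl (by norm_num) hx hx (w := 0) (by norm_num)
  simpa using this

theorem volume_norm_le_exp_le_of_polydisc {n : ℕ} (hn : 0 < n) {a b : ℝ} (hab : a < b)
    {F : (Fin n → ℂ) → ℂ} (hF : DifferentiableOn ℂ F (polydisc n a b))
    (hle : ∀ z ∈ polydisc n a b, ‖F z‖ ≤ 1) {p : Fin n → ℝ} (hp : ∀ k, p k ∈ Set.Icc a b)
    {L σ : ℝ} (hL0 : 0 < L) (hL : Real.exp (-L) ≤ ‖F fun k => (p k : ℂ)‖) :
    volume {x : Fin n → ℝ | (∀ k, x k ∈ Set.Icc a b) ∧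
      ‖F fun k => (x k : ℂ)‖ ≤ Real.exp (-(σ * L))} ≤
      ENNReal.ofReal (10 * Real.exp ((81 - σ) / 8) * (2 * (b - a) ^ n) * (100 * n + 1)) := by
  set E := {x : Fin n → ℝ | (∀ k, x k ∈ Set.Icc a b) ∧
      ‖F fun k => (x k : ℂ)‖ ≤ Real.exp (-(σ * L))} with hEdef
  have hΩ : {x : Fin n → ℝ | ∀ k, x k ∈ Set.Icc a b} = Set.Icc (fun _ => a) (fun _ => b) := by
    ext x
    simp [Set.mem_Icc, Pi.le_def, forall_and]
  have hE : MeasurableSet E := by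
    have hc : ContinuousOn (fun x : Fin n → ℝ => ‖F fun k => (x k : ℂ)‖)
        {x : Fin n → ℝ | ∀ k, x k ∈ Set.Icc a b} := by
      refine (hF.continuousOn.comp (f := fun (x : Fin n → ℝ) k => (x k : ℂ)) ?_ ?_).norm
      · fun_prop
      · exact fun x hx => real_mem_polydisc hab hx
    have hcl : IsClosed {x : Fin n → ℝ | ∀ k, x k ∈ Set.Icc a b} := by
      rw [hΩ]
      exact isClosed_Icc
    exact (hc.preimage_isClosed_of_isClosed hcl isClosed_Iic).measurableSet
  have hn' : (1 : ℝ) ≤ n := by exact_mod_cast hn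
  set η : ℝ := 1 / (100 * n) with hη
  have hη0 : 0 < η := by positivity
  have hη1 : η ≤ 1 / 100 := by
    rw [hη]
    exact one_div_le_one_div_of_le (by norm_num) (by linarith)
  set s : ℝ := 1 - 1 / (100 * n + 1) with hs
  have hsη : s * (1 + η) = 1 := by
    rw [hs, hη]
    field_simp
    ring
  have hs0 : 0 < s := by
    by_contra h
    nlinarith
  have hs1 : 1 / 2 ≤ s ^ n := by
    have h := one_add_mul_le_pow (a := -(1 / (100 * n + 1 : ℝ))) (by
      rw [neg_le_neg_iff, div_le_iff₀ (by positivity)]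
      linarith) n
    rw [← sub_eq_add_neg, ← hs] at h
    refine le_trans ?_ h
    have h2 : (n : ℝ) * (1 / (100 * n + 1)) ≤ 1 / 2 := by
      rw [mul_one_div, div_le_iff₀ (by positivity)]
      linarith
    linarith
  set X : Set (Fin n → ℝ) := {x | p + s • (x - p) ∈ {x : Fin n → ℝ | ∀ k, x k ∈ Set.Icc a b}}
    with hX
  have hXvol : volume X ≤ ENNReal.ofReal (2 * (b - a) ^ n) := by
    have h := volume_preimage_homothety p hs0 {x : Fin n → ℝ | ∀ k, x k ∈ Set.Icc a b}
    rw [← hX, hΩ, Real.volume_Icc_pi, Finset.prod_const, Finset.card_univ, Fintype.card_fin,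
      ← ENNReal.ofReal_pow (by linarith)] at h
    rw [ENNReal.ofReal_mul (by norm_num), h, ← mul_assoc,
      ← ENNReal.ofReal_mul (by norm_num)]
    exact le_mul_of_one_le_left zero_le (ENNReal.one_le_ofReal.2 (by linarith))
  have hslice : ∀ x ∈ X, volume {t : ℝ | t ∈ Set.Icc (0 : ℝ) 1 ∧ p + t • (x - p) ∈ E} ≤
      ENNReal.ofReal (10 * Real.exp ((81 - σ) / 8)) := by
    intro x hx
    have hxeq : ∀ k, (1 + η) * ((p + s • (x - p)) k - p k) = x k - p k := by
      intro k
      simp only [Pi.add_apply, Pi.smul_apply, Pi.sub_apply, smul_eq_mul]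
      linear_combination (x k - p k) * hsη
    have hline : ∀ w : ℂ, ‖w‖ < 21 / 20 →
        (fun k => (p k : ℂ) + (1 / 2 + 5 / 4 * w) * ((x k - p k : ℝ) : ℂ)) ∈
          polydisc n a b := by
      intro w hw
      have h := line_mem_polydisc hab hη0.le hη1 hp hx hw
      simpa only [hxeq] using h
    have h := volume_norm_le_exp_le (R := 21 / 20) (σ := σ) (w₀ := -(2 / 5)) (L := L)
      (f := fun w => F fun k => (p k : ℂ) + (1 / 2 + 5 / 4 * w) * ((x k - p k : ℝ) : ℂ))
      (by norm_num) (by norm_num) ?_ ?_ (by norm_num) hL0 ?_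
    · refine (measure_mono ?_).trans h
      rintro t ⟨ht, htE⟩
      refine ⟨ht, ?_⟩
      have h2 := htE.2
      convert h2 using 4 with k
      simp only [Pi.add_apply, Pi.smul_apply, Pi.sub_apply, smul_eq_mul]
      push_cast
      ring
    · refine hF.comp (g := F) ?_ ?_
      · fun_prop
      · intro w hw
        exact hline w (by simpa using hw)
    · intro w hw
      refine hle _ (hline w ?_)
      rw [mem_closedBall_zero_iff] at hw
      linarith
    · convert hL using 4 with k
      norm_num
  have hmain := volume_le_of_radial_slices p hE hs0 (X := X) ?_ hslice
  · have hba : 0 ≤ b - a := by linarith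
    have hs2 : 1 - s = 1 / (100 * n + 1) := by
      rw [hs]
      ring
    have h100 : (0 : ℝ) < 100 * n + 1 := by positivity
    rw [hs2] at hmain
    have h3 := mul_le_mul_left (hmain.trans (mul_le_mul_right hXvol _))
      (ENNReal.ofReal (100 * n + 1))
    rw [mul_assoc, ← ENNReal.ofReal_mul (by positivity), one_div, inv_mul_cancel₀ h100.ne',
      ENNReal.ofReal_one, mul_one, ← ENNReal.ofReal_mul (by positivity),
      ← ENNReal.ofReal_mul (by positivity)] at h3
    exact h3
  · intro x t hst ht1 hxt k
    obtain ⟨h1, h2⟩ := hxt.1 k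
    obtain ⟨h3, h4⟩ := hp k
    simp only [Pi.add_apply, Pi.smul_apply, Pi.sub_apply, smul_eq_mul] at h1 h2 ⊢
    rcases le_total 0 (x k - p k) with h5 | h5
    · constructor <;> nlinarith
    · constructor <;> nlinarith

end Cube

section MatrixFunction

theorem analyticOnNhd_det {E ι : Type*} [NormedAddCommGroup E] [NormedSpace ℂ E] [Fintype ι]
    [DecidableEq ι] {G : E → Matrix ι ι ℂ} {s : Set E}
    (h : ∀ i j, AnalyticOnNhd ℂ (fun z => G z i j) s) :
    AnalyticOnNhd ℂ (fun z => (G z).det) s := by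
  simp only [Matrix.det_apply']
  refine Finset.analyticOnNhd_fun_sum _ fun σ _ => analyticOnNhd_const.mul ?_
  exact Finset.analyticOnNhd_fun_prod (A := ℂ) _ fun i _ => h _ _

variable {n N : ℕ} {a b B₁ B₂ B₃ : ℝ} {Γ : (Fin n → ℂ) → Matrix (Fin N) (Fin N) ℂ}
  {p : Fin n → ℝ}

/-- A quantitative stability statement: if the condition number `B₁ * B₃` at one point of the cube
is close to `1`, then the function is uniformly invertible on the whole cube. -/
theorem euclNorm_le_of_mul_le (hab : a < b)
    (hΓ : ∀ i j, DifferentiableOn ℂ (fun z => Γ z i j) (polydisc n a b))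
    (hle : ∀ z ∈ polydisc n a b, ∀ v, euclNorm ((Γ z).mulVec v) ≤ B₁ * euclNorm v)
    (hp : ∀ k, p k ∈ Set.Icc a b) (hB₁ : 1 ≤ B₁) (hB₃ : 1 ≤ B₃)
    (hinv : ∀ v, euclNorm v ≤ B₃ * euclNorm ((Γ fun k => (p k : ℂ)).mulVec v))
    (hsmall : B₁ * B₃ ≤ 161 / 160) {x : Fin n → ℝ} (hx : ∀ k, x k ∈ Set.Icc a b)
    (v : Fin N → ℂ) :
    euclNorm v ≤ (B₁ * B₃) ^ 160 * B₃ * euclNorm ((Γ fun k => (x k : ℂ)).mulVec v) := by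
  set M := B₁ * B₃ with hM
  have hM1 : 1 ≤ M := by nlinarith
  set u := (Γ fun k => (p k : ℂ)).mulVec v with hu
  set y := (Γ fun k => (x k : ℂ)).mulVec v with hy
  have hu0 := euclNorm_nonneg u
  have hy0 := euclNorm_nonneg y
  have hv := hinv v
  rcases hu0.eq_or_lt with h0 | hupos
  · rw [← h0, mul_zero] at hv
    exact hv.trans (by positivity)
  set γ : ℂ → Fin n → ℂ := fun w k =>
    (p k : ℂ) + (1 / 2 + 5 / 4 * w) * ((x k - p k : ℝ) : ℂ) with hγ
  have hline : ∀ w : ℂ, ‖w‖ < 21 / 20 → γ w ∈ polydisc n a b := by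
    intro w hw
    have h := line_mem_polydisc hab le_rfl (by norm_num) hp hx hw
    simpa only [add_zero, one_mul] using h
  have hγx : γ (2 / 5) = fun k => (x k : ℂ) := by
    ext k
    simp only [hγ]
    push_cast
    ring
  have hγp : γ (-(2 / 5)) = fun k => (p k : ℂ) := by
    ext k
    simp only [hγ]
    push_cast
    ring
  have h := harnack_re (f := fun w => ((M * euclNorm u ^ 2 : ℝ) : ℂ) -
    star u ⬝ᵥ (Γ (γ w)).mulVec v) (z := 2 / 5) (w := -(2 / 5)) ?_ ?_ (by norm_num) (by norm_num)
  · simp only [hγx, hγp, ← hy, ← hu, star_dotProduct_self, Complex.sub_re,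
      Complex.ofReal_re] at h
    have h1 : (star u ⬝ᵥ y).re ≤ euclNorm u * euclNorm y :=
      (Complex.re_le_norm _).trans (norm_star_dotProduct_le u y)
    have h2 : (81 - 80 * M) * euclNorm u ≤ euclNorm y := by
      refine le_of_mul_le_mul_left ?_ hupos
      nlinarith
    have h3 : 1 + 160 * (M - 1) ≤ M ^ 160 := by
      have := one_add_mul_le_pow (a := M - 1) (by linarith) 160
      simpa using this
    have h4 : 1 ≤ (81 - 80 * M) * M ^ 160 := by
      nlinarith
    have h5 : euclNorm u ≤ M ^ 160 * euclNorm y := by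
      have hM160 : 0 < M ^ 160 := by positivity
      calc euclNorm u ≤ ((81 - 80 * M) * M ^ 160) * euclNorm u :=
            le_mul_of_one_le_left hu0 h4
        _ = M ^ 160 * ((81 - 80 * M) * euclNorm u) := by ring
        _ ≤ _ := mul_le_mul_of_nonneg_left h2 hM160.le
    calc euclNorm v ≤ B₃ * euclNorm u := hv
      _ ≤ B₃ * (M ^ 160 * euclNorm y) := mul_le_mul_of_nonneg_left h5 (by linarith)
      _ = _ := by ring
  · refine (differentiableOn_const _).sub ?_
    simp only [dotProduct, Matrix.mulVec]
    refine DifferentiableOn.fun_sum fun i _ => DifferentiableOn.const_mul ?_ _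
    refine DifferentiableOn.fun_sum fun j _ => DifferentiableOn.mul_const ?_ _
    refine (hΓ i j).comp (g := fun z => Γ z i j) (f := γ) ?_ ?_
    · fun_prop
    · intro w hw
      rw [mem_ball_zero_iff] at hw
      exact hline w (by linarith)
  · intro w hw
    rw [mem_ball_zero_iff] at hw
    have h1 := norm_star_dotProduct_le u ((Γ (γ w)).mulVec v)
    have h2 := hle _ (hline w (by linarith)) v
    have h3 := (Complex.re_le_norm _).trans h1
    rw [Complex.sub_re, Complex.ofReal_re, sub_nonneg]
    refine h3.trans ?_
    have h4 : euclNorm ((Γ (γ w)).mulVec v) ≤ M * euclNorm u :=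
      calc _ ≤ B₁ * euclNorm v := h2
        _ ≤ B₁ * (B₃ * euclNorm u) := mul_le_mul_of_nonneg_left hv (by linarith)
        _ = _ := by rw [hM]; ring
    calc _ ≤ euclNorm u * (M * euclNorm u) := mul_le_mul_of_nonneg_left h4 hu0
      _ = _ := by ring

set_option maxHeartbeats 800000 in
theorem volume_small_vector_le (hn : 0 < n) (hab : a < b)
    (hΓ : ∀ i j, AnalyticOnNhd ℂ (fun z => Γ z i j) (polydisc n a b))
    (hle : ∀ z ∈ polydisc n a b, ∀ v, euclNorm ((Γ z).mulVec v) ≤ B₁ * euclNorm v)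
    (hB₁ : 1 ≤ B₁) (hB₂ : 1 ≤ B₂) (hB₃ : 1 ≤ B₃) {J : Finset (Fin N)} {m : ℕ} (hm : 0 < m)
    (hJ : J.card ≤ m)
    (hD : ∀ z ∈ polydisc n a b, IsUnit (complSubmatrix (Γ z) J))
    (hDb : ∀ z ∈ polydisc n a b, ∀ y, euclNorm y ≤
      B₂ * euclNorm ((complSubmatrix (Γ z) J).mulVec y))
    (hp : ∀ k, p k ∈ Set.Icc a b)
    (hinv : ∀ v, euclNorm v ≤ B₃ * euclNorm ((Γ fun k => (p k : ℂ)).mulVec v))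
    {E : ℝ} (hE : 2 * (B₁ * B₂ * B₃) ^ 2 ≤ E) {K : ℝ} (hK : 2 * B₂ ≤ K) :
    volume {x : Fin n → ℝ | (∀ k, x k ∈ Set.Icc a b) ∧
      ∃ v ≠ 0, K * euclNorm ((Γ fun k => (x k : ℂ)).mulVec v) ≤ euclNorm v} ≤
      ENNReal.ofReal (2020 * Real.exp 11 * n * (b - a) ^ n *
        K ^ (-(1 / (16 * m * Real.log E)))) := by
  have hK0 : 0 < K := by linarith
  set q := B₁ * B₂ with hq
  have hq1 : 1 ≤ q := by nlinarith
  have hqB : q ≤ q * B₃ := by nlinarith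
  have hBq : B₃ ≤ q * B₃ := by nlinarith
  have hs : 2 * q ^ 2 ≤ E := by nlinarith
  have hE2 : 2 ≤ E := by nlinarith
  have hB₃E : B₃ ≤ E := by nlinarith
  have hE0 : 0 < E := by linarith
  have hlogE : 0 < Real.log E := Real.log_pos (by linarith)
  have hm' : (1 : ℝ) ≤ m := by exact_mod_cast hm
  have hn' : (1 : ℝ) ≤ n := by exact_mod_cast hn
  have hcard : Fintype.card {i : Fin N // i ∈ J} = J.card := by simp
  have hschur := fun z (hz : z ∈ polydisc n a b) =>
    exists_schur_complement (Γ z) J hB₁ hB₂ (hle z hz) (hD z hz) (hDb z hz)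
  set F : (Fin n → ℂ) → ℂ := fun z =>
    (Γ z).det / (complSubmatrix (Γ z) J).det / ((E ^ m : ℝ) : ℂ) with hF
  have hnormF : ∀ z, ‖F z‖ = ‖(Γ z).det / (complSubmatrix (Γ z) J).det‖ / E ^ m := fun z => by
    rw [hF, norm_div _ ((E ^ m : ℝ) : ℂ), Complex.norm_real, Real.norm_eq_abs,
      abs_of_pos (by positivity)]
  have hpow : ∀ {c : ℝ} {r : ℕ}, 0 ≤ c → c ≤ E ^ r → c ^ J.card ≤ E ^ (r * m) := by
    intro c r hc hcE
    rw [pow_mul]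
    refine (pow_le_pow_left₀ hc hcE _).trans (pow_le_pow_right₀ ?_ hJ)
    exact one_le_pow₀ (by linarith)
  have hFdiff : DifferentiableOn ℂ F (polydisc n a b) := by
    simp only [hF, div_eq_mul_inv _ ((E ^ m : ℝ) : ℂ)]
    have hdet : AnalyticOnNhd ℂ (fun z => (complSubmatrix (Γ z) J).det) (polydisc n a b) :=
      analyticOnNhd_det fun i j => hΓ i j
    refine ((analyticOnNhd_det hΓ).div hdet fun z hz => ?_).differentiableOn.mul_const _
    exact ((Matrix.isUnit_iff_isUnit_det _).1 (hD z hz)).ne_zero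
  have hFle : ∀ z ∈ polydisc n a b, ‖F z‖ ≤ 1 := by
    intro z hz
    obtain ⟨S, hS, hSle, -⟩ := hschur z hz
    rw [hnormF, hS, div_le_one (by positivity)]
    refine (norm_det_le_pow hSle).trans ?_
    rw [hcard]
    simpa using hpow (r := 1) (by positivity) (by simpa using hs)
  have hFp : Real.exp (-(2 * m * Real.log E)) ≤ ‖F fun k => (p k : ℂ)‖ := by
    obtain ⟨S, hS, -, hSlow, -⟩ := hschur _ (real_mem_polydisc hab hp)
    have h1 := pow_le_norm_det (S := S) (s := B₃⁻¹) (by positivity) fun x => by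
      rw [inv_mul_le_iff₀ (by linarith)]
      exact hSlow B₃ hinv x
    have h2 : Real.exp (-(2 * m * Real.log E)) = (E ^ m)⁻¹ / E ^ m := by
      rw [Real.exp_neg, mul_assoc, mul_comm (2 : ℝ), mul_assoc, Real.exp_nat_mul,
        mul_comm (Real.log E), two_mul, Real.exp_add, Real.exp_log hE0, mul_pow]
      field_simp
    rw [hnormF, hS, h2]
    gcongr
    refine le_trans ?_ h1
    rw [hcard, inv_pow]
    have h3 : 0 < B₃ ^ J.card := by positivity
    gcongr
    simpa using hpow (r := 1) (by linarith) (by simpa using hB₃E)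
  have hmain := volume_norm_le_exp_le_of_polydisc hn hab hFdiff hFle hp
    (L := 2 * m * Real.log E) (σ := Real.log K / (2 * m * Real.log E) - 5) (by positivity) hFp
  refine (measure_mono ?_).trans (hmain.trans (ENNReal.ofReal_le_ofReal ?_))
  · rintro x ⟨hx, v, hv, hvK⟩
    refine ⟨hx, ?_⟩
    obtain ⟨S, hS, hSle, -, hSsmall⟩ := hschur _ (real_mem_polydisc hab hx)
    obtain ⟨y, hy, hSy⟩ := hSsmall K hK v hv hvK
    have h1 := norm_det_le_of_euclNorm_mulVec_le (by nlinarith) (by positivity) hSle hy hSy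
    have h2 : Real.exp (-((Real.log K / (2 * m * Real.log E) - 5) * (2 * m * Real.log E))) =
        E ^ (10 * m) / K := by
      rw [sub_mul, div_mul_cancel₀ _ (by positivity), neg_sub, Real.exp_sub, Real.exp_log hK0]
      congr 1
      rw [show 5 * (2 * m * Real.log E) = ((10 * m : ℕ) : ℝ) * Real.log E by push_cast; ring,
        Real.exp_nat_mul, Real.exp_log hE0]
    rw [hnormF, hS, h2, div_le_iff₀ (by positivity)]
    refine h1.trans ?_
    rw [hcard, mul_div_assoc', div_mul_eq_mul_div]
    refine div_le_div_of_nonneg_right ?_ hK0.le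
    have h3 : (2 * (2 * q ^ 2)) ^ J.card ≤ E ^ (2 * m) :=
      hpow (by positivity) (by nlinarith)
    have h4 : 8 * q ^ 2 ≤ E ^ (3 * m) := by
      refine le_trans ?_ (pow_le_pow_right₀ (by linarith) (show 3 ≤ 3 * m by lia))
      nlinarith [mul_le_mul hE2 hE2 (by norm_num) (by linarith)]
    calc _ ≤ E ^ (2 * m) * E ^ (3 * m) := by gcongr
      _ = E ^ (2 * m + 3 * m) := (pow_add _ _ _).symm
      _ ≤ E ^ (10 * m + m) := pow_le_pow_right₀ (by linarith) (by lia)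
      _ = _ := pow_add _ _ _
  · have hexp : Real.exp ((81 - (Real.log K / (2 * m * Real.log E) - 5)) / 8) ≤
        Real.exp 11 * K ^ (-(1 / (16 * m * Real.log E))) := by
      rw [Real.rpow_def_of_pos hK0, ← Real.exp_add, Real.exp_le_exp]
      have : Real.log K * -(1 / (16 * m * Real.log E)) =
          -(Real.log K / (2 * m * Real.log E) / 8) := by
        field_simp
        ring
      rw [this]
      linarith
    have hba : 0 ≤ b - a := by linarith
    have h101 : 100 * (n : ℝ) + 1 ≤ 101 * n := by linarith
    calc _ ≤ 10 * (Real.exp 11 * K ^ (-(1 / (16 * m * Real.log E)))) * (2 * (b - a) ^ n) *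
          (101 * n) := by gcongr
      _ = _ := by ring

end MatrixFunction

theorem withDensity_ofReal_apply_le {α : Type*} [MeasurableSpace α] {μ : Measure α} [SFinite μ]
    {g : α → ℝ} {c : ℝ} (hg : ∀ y, g y ≤ c) (s : Set α) :
    (μ.withDensity fun y => ENNReal.ofReal (g y)) s ≤ ENNReal.ofReal c * μ s := by
  rw [withDensity_apply']
  refine (lintegral_mono fun y => ENNReal.ofReal_le_ofReal (hg y)).trans ?_
  rw [setLIntegral_const]

/-- **Matrix-valued Cartan lemma (Bourgain).**
There are absolute constants `C, c > 0` such that:  for positive integers `n, N, m` with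
`m ≤ N`, reals `B₁, B₂, B₃ > 1`, an interval `[a,b] ⊂ ℝ`, with `Ω = [a,b]^n` and `D` the
complex disc of centre `(a+b)/2` and radius `(e/2)(b−a)`, and `Γ` an analytic self-adjoint
`N×N`-matrix-valued function on `D^n` (entrywise analytic, Hermitian at real points)
such that
(1) `‖Γ(z)‖ < B₁` on `D^n`;
(2) there is `J ⊆ {1,…,N}` with `|J| ≤ m` whose complementary principal submatrix is
invertible with inverse of norm `< B₂` throughout `D^n`;
(3) `‖Γ(ω')⁻¹‖ < B₃` for some `ω' ∈ Ω`;
then for any measure `μ` on `Ω` with density `g` bounded by `gB` w.r.t. Lebesgue measure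
and every `K > 0`,
`μ{x ∈ Ω : Γ(x) not invertible or ‖Γ(x)⁻¹‖ > K} ≤ C gB n (b−a)^n K^(−c/(m log(B₁B₂B₃)))`. -/
theorem matrix_cartan_lemma :
    ∃ C c : ℝ, 0 < C ∧ 0 < c ∧
      ∀ (n N m : ℕ), 0 < n → 0 < N → 0 < m → m ≤ N →
      ∀ (B₁ B₂ B₃ : ℝ), 1 < B₁ → 1 < B₂ → 1 < B₃ →
      ∀ (a b : ℝ), a < b →
      ∀ (Γ : (Fin n → ℂ) → Matrix (Fin N) (Fin N) ℂ),
        -- entrywise analyticity on the polydisc `D^n`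
        (∀ i j : Fin N, AnalyticOnNhd ℂ (fun z => Γ z i j)
          {z : Fin n → ℂ | ∀ k, z k ∈ Metric.ball (((a + b) / 2 : ℝ) : ℂ)
            (Real.exp 1 / 2 * (b - a))}) →
        -- self-adjointness at real points of `Ω = [a,b]^n`
        (∀ x : Fin n → ℝ, (∀ k, x k ∈ Set.Icc a b) →
          (Γ (fun k => (x k : ℂ))).IsHermitian) →
        -- (1) uniform bound on the polydisc
        (∀ z : Fin n → ℂ, (∀ k, z k ∈ Metric.ball (((a + b) / 2 : ℝ) : ℂ)
            (Real.exp 1 / 2 * (b - a))) → opNorm (Γ z) < B₁) →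
        -- (2) invertibility of a complementary principal submatrix
        (∃ J : Finset (Fin N), J.card ≤ m ∧
          ∀ z : Fin n → ℂ, (∀ k, z k ∈ Metric.ball (((a + b) / 2 : ℝ) : ℂ)
              (Real.exp 1 / 2 * (b - a))) →
            IsUnit ((Γ z).submatrix (fun i : {i : Fin N // i ∉ J} => (i : Fin N))
                      (fun i : {i : Fin N // i ∉ J} => (i : Fin N))) ∧
            opNorm (((Γ z).submatrix (fun i : {i : Fin N // i ∉ J} => (i : Fin N))
                      (fun i : {i : Fin N // i ∉ J} => (i : Fin N)))⁻¹) < B₂) →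
        -- (3) invertibility at one real point
        (∃ ω' : Fin n → ℝ, (∀ k, ω' k ∈ Set.Icc a b) ∧
          IsUnit (Γ (fun k => ((ω' k : ℝ) : ℂ))) ∧
          opNorm ((Γ (fun k => ((ω' k : ℝ) : ℂ)))⁻¹) < B₃) →
      ∀ (g : (Fin n → ℝ) → ℝ) (gB : ℝ), Measurable g → (∀ y, 0 ≤ g y) →
        (∀ y, g y ≤ gB) →
      ∀ K : ℝ, 0 < K →
        (volume.withDensity fun y => ENNReal.ofReal (g y))
            {x : Fin n → ℝ | (∀ k, x k ∈ Set.Icc a b) ∧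
              (¬ IsUnit (Γ (fun k => ((x k : ℝ) : ℂ))) ∨
                K < opNorm ((Γ (fun k => ((x k : ℝ) : ℂ)))⁻¹))}
          ≤ ENNReal.ofReal
              (C * gB * n * (b - a) ^ n *
                K ^ (-c / (m * Real.log (B₁ * B₂ * B₃)))) := by
  refine ⟨2020 * Real.exp 11, 1 / 2592, by positivity, by norm_num, ?_⟩
  intro n N m hn hN hm hmN B₁ B₂ B₃ hB₁ hB₂ hB₃ a b hab Γ hΓ _ hle ⟨J, hJ, hD⟩ ⟨p, hp, hpu, hpi⟩
    g gB hg hg0 hgB K hK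
  have hgB0 : 0 ≤ gB := (hg0 0).trans (hgB 0)
  have hm' : (1 : ℝ) ≤ m := by exact_mod_cast hm
  have hn' : (1 : ℝ) ≤ n := by exact_mod_cast hn
  have hba : 0 < b - a := sub_pos.2 hab
  have hB₂₃ : 1 < B₂ * B₃ := by nlinarith
  have hB₁₂ : 1 < B₁ * B₂ := by nlinarith
  set B := B₁ * B₂ * B₃ with hB
  have hB1 : 1 < B := by nlinarith
  have hlogB : 0 < Real.log B := Real.log_pos hB1
  have hMle : ∀ z ∈ polydisc n a b, ∀ v, euclNorm ((Γ z).mulVec v) ≤ B₁ * euclNorm v :=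
    fun z hz v => (euclNorm_mulVec_le _ _).trans
      (mul_le_mul_of_nonneg_right (hle z hz).le (euclNorm_nonneg v))
  have hpinv := euclNorm_le_of_opNorm_inv_le hpu hpi.le
  set bad := {x : Fin n → ℝ | (∀ k, x k ∈ Set.Icc a b) ∧
    (¬ IsUnit (Γ (fun k => ((x k : ℝ) : ℂ))) ∨
      K < opNorm ((Γ (fun k => ((x k : ℝ) : ℂ)))⁻¹))} with hbad
  suffices h : volume bad ≤ ENNReal.ofReal (2020 * Real.exp 11 * n * (b - a) ^ n *
      K ^ (-(1 / 2592) / (m * Real.log B))) by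
    refine (withDensity_ofReal_apply_le hgB bad).trans ?_
    refine (mul_le_mul_right h _).trans ?_
    rw [← ENNReal.ofReal_mul hgB0]
    exact (congrArg ENNReal.ofReal (by ring)).le
  rcases lt_or_ge K (B ^ 161) with hKB | hKB
  · have hcube : volume bad ≤ ENNReal.ofReal ((b - a) ^ n) := by
      have hsub : bad ⊆ Set.Icc (fun _ => a) (fun _ => b) :=
        fun x hx => ⟨fun k => (hx.1 k).1, fun k => (hx.1 k).2⟩
      refine (measure_mono hsub).trans_eq ?_
      rw [Real.volume_Icc_pi, Finset.prod_const, Finset.card_univ, Fintype.card_fin,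
        ENNReal.ofReal_pow hba.le]
    refine hcube.trans (ENNReal.ofReal_le_ofReal ?_)
    have hrpow : Real.exp (-1) ≤ K ^ (-(1 / 2592) / (m * Real.log B)) := by
      rw [Real.rpow_def_of_pos hK, Real.exp_le_exp]
      have h1 : Real.log K ≤ 161 * Real.log B := by
        have := Real.log_le_log hK hKB.le
        rwa [Real.log_pow] at this
      have h2 : 0 < m * Real.log B := by positivity
      rw [mul_div_assoc', le_div_iff₀ h2]
      nlinarith
    have hexp : 1 ≤ 2020 * Real.exp 11 * n * K ^ (-(1 / 2592) / (m * Real.log B)) := by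
      have h1 : 1 ≤ Real.exp 11 * Real.exp (-1) := by
        rw [← Real.exp_add]
        exact Real.one_le_exp (by norm_num)
      calc (1 : ℝ) ≤ 1 * (Real.exp 11 * Real.exp (-1)) * 1 := by linarith
        _ ≤ 2020 * (Real.exp 11 * K ^ (-(1 / 2592) / (m * Real.log B))) * n := by
            gcongr
            norm_num
        _ = _ := by ring
    calc (b - a) ^ n = 1 * (b - a) ^ n := (one_mul _).symm
      _ ≤ (2020 * Real.exp 11 * n * K ^ (-(1 / 2592) / (m * Real.log B))) * (b - a) ^ n := by
          gcongr
      _ = _ := by ring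
  rcases le_or_gt (B₁ * B₃) (161 / 160) with hsmall | hlarge
  · have hempty : bad = ∅ := by
      refine Set.eq_empty_iff_forall_notMem.2 fun x hx => ?_
      have h := euclNorm_le_of_mul_le hab (fun i j => (hΓ i j).differentiableOn) hMle hp hB₁.le
        hB₃.le hpinv hsmall hx.1
      obtain ⟨hu, hb⟩ := isUnit_and_opNorm_inv_le (by positivity) h
      refine hx.2.elim (fun h' => h' hu) fun h' => h'.not_ge (hb.trans (le_trans ?_ hKB))
      have h1 : B₁ * B₃ ≤ B := by nlinarith
      have h2 : B₃ ≤ B := by nlinarith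
      calc (B₁ * B₃) ^ 160 * B₃ ≤ B ^ 160 * B := by gcongr
        _ = _ := (pow_succ _ _).symm
    rw [hempty, measure_empty]
    exact zero_le
  · have hB160 : 2 ≤ B ^ 160 := by
      have h1 : 161 / 160 ≤ B := by nlinarith
      have h2 := one_add_mul_le_pow (a := B - 1) (by linarith) 160
      rw [add_sub_cancel] at h2
      refine le_trans ?_ h2
      push_cast
      linarith
    have hE : 2 * B ^ 2 ≤ B ^ 162 := by
      rw [show B ^ 162 = B ^ 160 * B ^ 2 by ring]
      gcongr
    have hKB₂ : 2 * B₂ ≤ K := by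
      refine le_trans ?_ hKB
      have h1 : B₂ ≤ B := by nlinarith
      calc 2 * B₂ ≤ B ^ 160 * B := by gcongr
        _ = _ := (pow_succ _ _).symm
    have hmain := volume_small_vector_le hn hab hΓ hMle hB₁.le hB₂.le hB₃.le hm hJ
      (fun z hz => (hD z hz).1)
      (fun z hz => euclNorm_le_of_opNorm_inv_le (hD z hz).1 (hD z hz).2.le) hp hpinv hE hKB₂
    refine (measure_mono ?_).trans (hmain.trans_eq ?_)
    · rintro x ⟨hx, hxbad⟩
      refine ⟨hx, ?_⟩
      by_contra! h
      obtain ⟨hu, hb⟩ := isUnit_and_opNorm_inv_le (M := Γ fun k => (x k : ℂ)) hK.le fun v => by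
        rcases eq_or_ne v 0 with rfl | hv
        · simp [euclNorm_zero]
        · exact (h v hv).le
      exact hxbad.elim (fun h' => h' hu) fun h' => h'.not_ge hb
    · rw [Real.log_pow]
      congr 3
      field_simp
      norm_num
end
end

section
/- Spectral projection bound via the resolvent: Let h be a bounded self-adjoint operator on a complex Hilbert space, ψ a vector, E ∈ ℝ, and ε > 0. Then ⟨ψ, 1_{(−∞,E)}(h) ψ⟩ ≤ (2/π) ∫_{−∞}^{E} Im ⟨ψ, (h − E' − iε)^{−1} ψ⟩ dE', where 1_{(−∞,E)}(h) denotes the spectral projection of h onto (−∞, E); the integrand is nonnegative and the integral is finite. -/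
set_option autoImplicit false

open MeasureTheory

noncomputable section

variable {H : Type*} [NormedAddCommGroup H] [InnerProductSpace ℂ H] [CompleteSpace H]

/-- `μ` is the spectral measure of the vector `ψ` for the bounded self-adjoint operator
`h`, characterized through the Borel–Stieltjes transform of the resolvent:
`⟨ψ, (h − z)⁻¹ ψ⟩ = ∫ (t − z)⁻¹ dμ(t)` for all `z` in the upper half-plane.
(For self-adjoint `h` such a finite measure exists and is unique, and
`⟨ψ, 1_B(h) ψ⟩ = μ(B)` for every Borel set `B`; in particular the spectral projection
`1_{(−∞,E)}(h)` satisfies `⟨ψ, 1_{(−∞,E)}(h) ψ⟩ = μ((−∞,E))`.) -/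
def IsSpecMeasure (h : H →L[ℂ] H) (ψ : H) (μ : Measure ℝ) : Prop :=
  IsFiniteMeasure μ ∧
    ∀ z : ℂ, 0 < z.im →
      inner (𝕜 := ℂ) ψ (Ring.inverse (h - z • (1 : H →L[ℂ] H)) ψ)
        = ∫ t : ℝ, ((t : ℂ) - z)⁻¹ ∂μ

open Filter Topology

/-- The Poisson kernel is integrable in its second variable. -/
theorem integrable_poisson (t : ℝ) {ε : ℝ} (hε : 0 < ε) :
    Integrable fun x : ℝ => ε / ((t - x) ^ 2 + ε ^ 2) := by
  convert ((integrable_inv_one_add_sq.comp_div hε.ne').comp_sub_right t).const_mul ε⁻¹ using 2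
    with x
  field_simp
  ring

/-- The half-line mass of the Poisson kernel is integrable against a finite measure. -/
theorem integrable_arctan_add_half_pi (μ : Measure ℝ) [IsFiniteMeasure μ] (E ε : ℝ) :
    Integrable (fun t : ℝ => Real.arctan ((E - t) / ε) + Real.pi / 2) μ := by
  refine .of_bound (by fun_prop) Real.pi (.of_forall fun t => ?_)
  have h₁ := Real.neg_pi_div_two_lt_arctan ((E - t) / ε)
  have h₂ := Real.arctan_lt_pi_div_two ((E - t) / ε)
  rw [Real.norm_eq_abs, abs_le]
  constructor <;> linarith [Real.pi_pos]

/-- The half-line integrals of the Poisson kernel are arctangents. -/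
theorem integral_Iio_poisson (t E : ℝ) {ε : ℝ} (hε : 0 < ε) :
    ∫ x in Set.Iio E, ε / ((t - x) ^ 2 + ε ^ 2) = Real.arctan ((E - t) / ε) + Real.pi / 2 := by
  rw [← integral_Iic_eq_integral_Iio, ← sub_neg_eq_add]
  refine integral_Iic_of_hasDerivAt_of_tendsto'
    (f := fun x : ℝ => Real.arctan ((x - t) / ε)) (fun x _ => ?_)
    (integrable_poisson t hε).integrableOn ?_
  · refine (((hasDerivAt_id x).sub_const t).div_const ε).arctan.congr_deriv ?_
    rw [id]
    field_simp
    ring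
  · refine (tendsto_nhds_of_tendsto_nhdsWithin Real.tendsto_arctan_atBot).comp ?_
    exact (tendsto_atBot_add_const_right atBot (-t) tendsto_id).atBot_div_const hε

/-- The Poisson kernel is jointly integrable over a finite measure times a half-line. -/
theorem integrable_prod_poisson (μ : Measure ℝ) [IsFiniteMeasure μ] (E : ℝ) {ε : ℝ}
    (hε : 0 < ε) :
    Integrable (fun p : ℝ × ℝ => ε / ((p.1 - p.2) ^ 2 + ε ^ 2))
      (μ.prod (volume.restrict (Set.Iio E))) := by
  have hcont : Continuous fun p : ℝ × ℝ => ε / ((p.1 - p.2) ^ 2 + ε ^ 2) :=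
    Continuous.div₀ (by fun_prop) (by fun_prop) fun p => by positivity
  rw [integrable_prod_iff hcont.aestronglyMeasurable]
  refine ⟨.of_forall fun t => (integrable_poisson t hε).integrableOn, ?_⟩
  simp_rw [fun t x : ℝ => Real.norm_of_nonneg
    (show 0 ≤ ε / ((t - x) ^ 2 + ε ^ 2) by positivity), integral_Iio_poisson _ E hε]
  exact integrable_arctan_add_half_pi μ E ε

/-- The imaginary part of the Borel–Stieltjes transform is the Poisson integral. -/
theorem im_integral_inv_sub (μ : Measure ℝ) [IsFiniteMeasure μ] (x : ℝ) {ε : ℝ} (hε : 0 < ε) :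
    (∫ t : ℝ, ((t : ℂ) - (x + ε * Complex.I))⁻¹ ∂μ).im
      = ∫ t, ε / ((t - x) ^ 2 + ε ^ 2) ∂μ := by
  have him (t : ℝ) : ((t : ℂ) - (x + ε * Complex.I)).im = -ε := by simp
  have hne (t : ℝ) : (t : ℂ) - (x + ε * Complex.I) ≠ 0 := fun h => by
    have := him t
    rw [h, Complex.zero_im] at this
    linarith
  have hint : Integrable (fun t : ℝ => ((t : ℂ) - (x + ε * Complex.I))⁻¹) μ := by
    refine .of_bound (Continuous.aestronglyMeasurable
      (Continuous.inv₀ (by fun_prop) hne)) ε⁻¹ (.of_forall fun t => ?_)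
    rw [norm_inv]
    refine inv_anti₀ hε ?_
    simpa [him, abs_of_pos hε] using Complex.abs_im_le_norm ((t : ℂ) - (x + ε * Complex.I))
  have := integral_im hint
  simp only [RCLike.im_to_complex] at this
  rw [← this]
  congr 1 with t
  rw [Complex.inv_im, him, Complex.normSq_apply, him]
  simp
  ring

/-- **Spectral projection bound via the resolvent.**
Let `h` be a bounded self-adjoint operator on a complex Hilbert space, `ψ` a vector,
`E ∈ ℝ` and `ε > 0`.  Then
`⟨ψ, 1_{(−∞,E)}(h) ψ⟩ ≤ (2/π) ∫_{−∞}^E Im ⟨ψ, (h − E' − iε)⁻¹ ψ⟩ dE'`,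
where `⟨ψ, 1_{(−∞,E)}(h) ψ⟩` is expressed as `μ((−∞,E))` for the spectral measure `μ`
of `ψ`. -/
theorem spectral_projection_bound
    (h : H →L[ℂ] H) (hsa : IsSelfAdjoint h) (ψ : H) (E : ℝ) (ε : ℝ) (hε : 0 < ε)
    (μ : Measure ℝ) (hμ : IsSpecMeasure h ψ μ) :
    (μ (Set.Iio E)).toReal
      ≤ (2 / Real.pi) *
        ∫ E' in Set.Iio E,
          (inner (𝕜 := ℂ) ψ
            (Ring.inverse (h - ((E' : ℂ) + (ε : ℂ) * Complex.I) • (1 : H →L[ℂ] H)) ψ)).im := by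
  obtain ⟨_, hres⟩ := hμ
  have hpoisson (x : ℝ) : (inner (𝕜 := ℂ) ψ
      (Ring.inverse (h - ((x : ℂ) + (ε : ℂ) * Complex.I) • (1 : H →L[ℂ] H)) ψ)).im
        = ∫ t, ε / ((t - x) ^ 2 + ε ^ 2) ∂μ := by
    rw [hres _ (by simpa using hε), im_integral_inv_sub μ x hε]
  simp_rw [hpoisson]
  rw [← integral_integral_swap (integrable_prod_poisson μ E hε)]
  simp_rw [integral_Iio_poisson _ E hε]
  have harctan := integrable_arctan_add_half_pi μ E ε
  calc (μ (Set.Iio E)).toReal = 2 / Real.pi * ∫ _ in Set.Iio E, Real.pi / 2 ∂μ := by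
        rw [setIntegral_const, smul_eq_mul, measureReal_def]
        field_simp
    _ ≤ 2 / Real.pi * ∫ t in Set.Iio E, (Real.arctan ((E - t) / ε) + Real.pi / 2) ∂μ := by
        gcongr ?_ * ?_
        refine setIntegral_mono_on (integrable_const _) harctan.integrableOn measurableSet_Iio
          fun t ht => le_add_of_nonneg_left (Real.arctan_nonneg.2 ?_)
        exact div_nonneg (sub_nonneg.2 (le_of_lt ht)) hε.le
    _ ≤ 2 / Real.pi * ∫ t, (Real.arctan ((E - t) / ε) + Real.pi / 2) ∂μ := by
        gcongr ?_ * ?_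
        refine setIntegral_le_integral harctan (.of_forall fun t => ?_)
        change 0 ≤ Real.arctan ((E - t) / ε) + Real.pi / 2
        linarith [Real.neg_pi_div_two_lt_arctan ((E - t) / ε)]
end
end
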